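/- arXiv:1803.07313 — 7 statements merged into one kernel-verified Lean document; each statement's English description precedes it below -/
import Mathlib

section
/- Subject Reduction for CD: if a proof term t has type C in the system CD (i.e. t : C is derivable from a context Γ) and t reduces in one step to u (t ↦ u), then u has type C in the same context; moreover, the free proof-term variables of u are among those of t. -/
/-! A Curry-Howard formalization of the intuitionistic first-order logic of
constant domains CD (Aschieri-Genco style), with de Bruijn indices both for
first-order variables and for proof-term variables. -/

/-- First-order terms: variables (de Bruijn), constants, function applications. -/
inductive Tm : Type where
  | var : ℕ → Tm
  | const : ℕ → Tm
  | func : ℕ → List Tm → Tm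

namespace Tm

/-- Lift (shift by `d`) the first-order variables `≥ c`. -/
def lift (d c : ℕ) : Tm → Tm
  | var i => if i < c then var i else var (i + d)
  | const k => const k
  | func f ts => func f (ts.attach.map fun x => lift d c x.1)
termination_by t => sizeOf t
decreasing_by have := List.sizeOf_lt_of_mem x.2; simp; omega

/-- Substitute the term `m` for the first-order variable `k` (variables `> k` are decremented). -/
def subst (k : ℕ) (m : Tm) : Tm → Tm
  | var i => if i = k then m else if i < k then var i else var (i - 1)
  | const c' => const c'
  | func f ts => func f (ts.attach.map fun x => subst k m x.1)
termination_by t => sizeOf t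
decreasing_by have := List.sizeOf_lt_of_mem x.2; simp; omega

end Tm

/-- First-order formulas, with de Bruijn quantifiers. -/
inductive Fml : Type where
  | atom : ℕ → List Tm → Fml
  | bot : Fml
  | conj : Fml → Fml → Fml
  | disj : Fml → Fml → Fml
  | impl : Fml → Fml → Fml
  | all : Fml → Fml
  | ex : Fml → Fml

namespace Fml

/-- Lift (shift by `d`) the free first-order variables `≥ c`. -/
def lift (d : ℕ) : ℕ → Fml → Fml
  | c, atom P ts => atom P (ts.map (Tm.lift d c))
  | _, bot => bot
  | c, conj A B => conj (lift d c A) (lift d c B)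
  | c, disj A B => disj (lift d c A) (lift d c B)
  | c, impl A B => impl (lift d c A) (lift d c B)
  | c, all A => all (lift d (c + 1) A)
  | c, ex A => ex (lift d (c + 1) A)

/-- Substitute the term `m` for the free first-order variable `k`. -/
def subst : ℕ → Tm → Fml → Fml
  | k, m, atom P ts => atom P (ts.map (Tm.subst k m))
  | _, _, bot => bot
  | k, m, conj A B => conj (subst k m A) (subst k m B)
  | k, m, disj A B => disj (subst k m A) (subst k m B)
  | k, m, impl A B => impl (subst k m A) (subst k m B)
  | k, m, all A => all (subst (k + 1) (m.lift 1 0) A)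
  | k, m, ex A => ex (subst (k + 1) (m.lift 1 0) A)

/-- Atomic formulas (including `⊥`, a 0-ary predicate symbol). -/
def Atomic : Fml → Prop
  | atom _ _ => True
  | bot => True
  | _ => False

end Fml

/-- Proof terms of CD. Proof-term variables are de Bruijn indices; `lam`
binds a proof variable, `qlam` binds a first-order variable, `case` binds one
proof variable in each branch, `edest` binds one first-order variable and one
proof variable in its second argument. `D A B` is the constant for the
constant-domain axiom `∀α(A ∨ B) → ∀α A ∨ B` (in de Bruijn style, `A` may
contain the bound variable `0` while `B` is a formula of the outer context,
so that "`α` does not occur in `B`" holds by construction). -/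
inductive Pf : Type where
  | var : ℕ → Pf
  | pair : Pf → Pf → Pf
  | proj : Bool → Pf → Pf
  | lam : Fml → Pf → Pf
  | app : Pf → Pf → Pf
  | inj : Bool → Pf → Pf
  | case : Pf → Pf → Pf → Pf
  | qlam : Pf → Pf
  | qapp : Pf → Tm → Pf
  | epair : Tm → Pf → Pf
  | edest : Pf → Pf → Pf
  | efq : Fml → Pf → Pf
  | D : Fml → Fml → Pf

namespace Pf

/-- Lift the free first-order variables `≥ c` by `d` in a proof term. -/
def tlift : Pf → ℕ → ℕ → Pf
  | var n, _, _ => var n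
  | pair u t, d, c => pair (tlift u d c) (tlift t d c)
  | proj b u, d, c => proj b (tlift u d c)
  | lam A u, d, c => lam (A.lift d c) (tlift u d c)
  | app u t, d, c => app (tlift u d c) (tlift t d c)
  | inj b u, d, c => inj b (tlift u d c)
  | case u w₁ w₂, d, c => case (tlift u d c) (tlift w₁ d c) (tlift w₂ d c)
  | qlam u, d, c => qlam (tlift u d (c + 1))
  | qapp u m, d, c => qapp (tlift u d c) (m.lift d c)
  | epair m u, d, c => epair (m.lift d c) (tlift u d c)
  | edest u v, d, c => edest (tlift u d c) (tlift v d (c + 1))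
  | efq P u, d, c => efq (P.lift d c) (tlift u d c)
  | D A B, d, c => D (A.lift d (c + 1)) (B.lift d c)

/-- Lift the free proof-term variables `≥ c` by `d` in a proof term. -/
def plift : Pf → ℕ → ℕ → Pf
  | var n, d, c => if n < c then var n else var (n + d)
  | pair u t, d, c => pair (plift u d c) (plift t d c)
  | proj b u, d, c => proj b (plift u d c)
  | lam A u, d, c => lam A (plift u d (c + 1))
  | app u t, d, c => app (plift u d c) (plift t d c)
  | inj b u, d, c => inj b (plift u d c)
  | case u w₁ w₂, d, c => case (plift u d c) (plift w₁ d (c + 1)) (plift w₂ d (c + 1))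
  | qlam u, d, c => qlam (plift u d c)
  | qapp u m, d, c => qapp (plift u d c) m
  | epair m u, d, c => epair m (plift u d c)
  | edest u v, d, c => edest (plift u d c) (plift v d (c + 1))
  | efq P u, d, c => efq P (plift u d c)
  | D A B, _, _ => D A B

/-- Substitute the proof term `q` for the proof variable `k` (variables `> k` decremented). -/
def psubst : Pf → ℕ → Pf → Pf
  | var n, k, q => if n = k then q else if n < k then var n else var (n - 1)
  | pair u t, k, q => pair (psubst u k q) (psubst t k q)
  | proj b u, k, q => proj b (psubst u k q)
  | lam A u, k, q => lam A (psubst u (k + 1) (plift q 1 0))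
  | app u t, k, q => app (psubst u k q) (psubst t k q)
  | inj b u, k, q => inj b (psubst u k q)
  | case u w₁ w₂, k, q =>
      case (psubst u k q) (psubst w₁ (k + 1) (plift q 1 0)) (psubst w₂ (k + 1) (plift q 1 0))
  | qlam u, k, q => qlam (psubst u k (tlift q 1 0))
  | qapp u m, k, q => qapp (psubst u k q) m
  | epair m u, k, q => epair m (psubst u k q)
  | edest u v, k, q => edest (psubst u k q) (psubst v (k + 1) (tlift (plift q 1 0) 1 0))
  | efq P u, k, q => efq P (psubst u k q)
  | D A B, _, _ => D A B

/-- Substitute the first-order term `m` for the first-order variable `k` in a proof term. -/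
def tsubst : Pf → ℕ → Tm → Pf
  | var n, _, _ => var n
  | pair u t, k, m => pair (tsubst u k m) (tsubst t k m)
  | proj b u, k, m => proj b (tsubst u k m)
  | lam A u, k, m => lam (A.subst k m) (tsubst u k m)
  | app u t, k, m => app (tsubst u k m) (tsubst t k m)
  | inj b u, k, m => inj b (tsubst u k m)
  | case u w₁ w₂, k, m => case (tsubst u k m) (tsubst w₁ k m) (tsubst w₂ k m)
  | qlam u, k, m => qlam (tsubst u (k + 1) (m.lift 1 0))
  | qapp u t, k, m => qapp (tsubst u k m) (Tm.subst k m t)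
  | epair t u, k, m => epair (Tm.subst k m t) (tsubst u k m)
  | edest u v, k, m => edest (tsubst u k m) (tsubst v (k + 1) (m.lift 1 0))
  | efq P u, k, m => efq (P.subst k m) (tsubst u k m)
  | D A B, k, m => D (A.subst (k + 1) (m.lift 1 0)) (B.subst k m)

/-- The set of free proof-term variables of a proof term. -/
def fvars : Pf → Set ℕ
  | var n => {n}
  | pair u t => fvars u ∪ fvars t
  | proj _ u => fvars u
  | lam _ u => {n | n + 1 ∈ fvars u}
  | app u t => fvars u ∪ fvars t
  | inj _ u => fvars u
  | case u w₁ w₂ => fvars u ∪ {n | n + 1 ∈ fvars w₁} ∪ {n | n + 1 ∈ fvars w₂}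
  | qlam u => fvars u
  | qapp u _ => fvars u
  | epair _ u => fvars u
  | edest u v => fvars u ∪ {n | n + 1 ∈ fvars v}
  | efq _ u => fvars u
  | D _ _ => ∅

end Pf

/-- The typing relation of CD: `Typed Γ t A` means that the proof term `t`
proves `A` from the (proof-variable) context `Γ`.  In the rules `qlam` and
`edest`, the side condition "the generalized first-order variable does not
occur in the context (resp. in the context and the conclusion)" is rendered,
de Bruijn style, by lifting. -/
inductive Typed : List Fml → Pf → Fml → Prop where
  | var {Γ n A} : Γ[n]? = some A → Typed Γ (.var n) A
  | pair {Γ u t A B} : Typed Γ u A → Typed Γ t B → Typed Γ (.pair u t) (.conj A B)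
  | projL {Γ u A B} : Typed Γ u (.conj A B) → Typed Γ (.proj false u) A
  | projR {Γ u A B} : Typed Γ u (.conj A B) → Typed Γ (.proj true u) B
  | lam {Γ u A B} : Typed (A :: Γ) u B → Typed Γ (.lam A u) (.impl A B)
  | app {Γ t u A B} : Typed Γ t (.impl A B) → Typed Γ u A → Typed Γ (.app t u) B
  | injL {Γ u A B} : Typed Γ u A → Typed Γ (.inj false u) (.disj A B)
  | injR {Γ u A B} : Typed Γ u B → Typed Γ (.inj true u) (.disj A B)
  | case {Γ u w₁ w₂ A B C} : Typed Γ u (.disj A B) → Typed (A :: Γ) w₁ C →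
      Typed (B :: Γ) w₂ C → Typed Γ (.case u w₁ w₂) C
  | qlam {Γ u A} : Typed (Γ.map (Fml.lift 1 0)) u A → Typed Γ (.qlam u) (.all A)
  | qapp {Γ u A} (m : Tm) : Typed Γ u (.all A) → Typed Γ (.qapp u m) (A.subst 0 m)
  | epair {Γ u A} (m : Tm) : Typed Γ u (A.subst 0 m) → Typed Γ (.epair m u) (.ex A)
  | edest {Γ u t A C} : Typed Γ u (.ex A) →
      Typed (A :: Γ.map (Fml.lift 1 0)) t (C.lift 1 0) → Typed Γ (.edest u t) C
  | efq {Γ u P} : Typed Γ u .bot → Fml.Atomic P → Typed Γ (.efq P u) P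
  | D {Γ A B} : Typed Γ (.D A B)
      (.impl (.all (.disj A (B.lift 1 0))) (.disj (.all A) B))

/-- The one-step reduction relation of CD: the standard intuitionistic
reductions, the two reductions for the constant-domain axiom constant `D`
(where the fixed constant `c` of the language is `Tm.const 0`), and closure
under every term context. -/
inductive Step : Pf → Pf → Prop where
  -- intuitionistic redexes
  | beta {A u t} : Step (.app (.lam A u) t) (u.psubst 0 t)
  | qbeta {u m} : Step (.qapp (.qlam u) m) (u.tsubst 0 m)
  | projPair {u₀ u₁ b} : Step (.proj b (.pair u₀ u₁)) (if b then u₁ else u₀)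
  | caseInj {b u w₁ w₂} : Step (.case (.inj b u) w₁ w₂) ((if b then w₂ else w₁).psubst 0 u)
  | edestPair {m u v} : Step (.edest (.epair m u) v) ((v.tsubst 0 m).psubst 0 u)
  -- redexes for the constant-domain axiom
  | DinjL {A B u} : Step (.app (.D A B) (.qlam (.inj false u))) (.inj false (.qlam u))
  | DinjR {A B u} : Step (.app (.D A B) (.qlam (.inj true u))) (.inj true (u.tsubst 0 (.const 0)))
  -- congruence closure
  | pairL {u u' t} : Step u u' → Step (.pair u t) (.pair u' t)
  | pairR {u t t'} : Step t t' → Step (.pair u t) (.pair u t')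
  | projC {b u u'} : Step u u' → Step (.proj b u) (.proj b u')
  | lamC {A u u'} : Step u u' → Step (.lam A u) (.lam A u')
  | appL {u u' t} : Step u u' → Step (.app u t) (.app u' t)
  | appR {u t t'} : Step t t' → Step (.app u t) (.app u t')
  | injC {b u u'} : Step u u' → Step (.inj b u) (.inj b u')
  | caseU {u u' w₁ w₂} : Step u u' → Step (.case u w₁ w₂) (.case u' w₁ w₂)
  | caseL {u w₁ w₁' w₂} : Step w₁ w₁' → Step (.case u w₁ w₂) (.case u w₁' w₂)
  | caseR {u w₁ w₂ w₂'} : Step w₂ w₂' → Step (.case u w₁ w₂) (.case u w₁ w₂')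
  | qlamC {u u'} : Step u u' → Step (.qlam u) (.qlam u')
  | qappC {u u' m} : Step u u' → Step (.qapp u m) (.qapp u' m)
  | epairC {m u u'} : Step u u' → Step (.epair m u) (.epair m u')
  | edestL {u u' v} : Step u u' → Step (.edest u v) (.edest u' v)
  | edestR {u v v'} : Step v v' → Step (.edest u v) (.edest u v')
  | efqC {P u u'} : Step u u' → Step (.efq P u) (.efq P u')

/-- A proof term is normal if no reduction applies to it. -/
def NormalForm (t : Pf) : Prop := ∀ u, ¬ Step t u

namespace Tm

theorem induction_on_mem {motive : Tm → Prop} (var : ∀ i, motive (.var i))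
    (const : ∀ k, motive (.const k))
    (func : ∀ f ts, (∀ t ∈ ts, motive t) → motive (.func f ts)) (t : Tm) : motive t :=
  Tm.rec (motive_1 := motive) (motive_2 := fun ts => ∀ t ∈ ts, motive t) var const func
    (by simp) (fun _ _ h hs => by simpa using ⟨h, hs⟩) t

theorem lift_func (d c f : ℕ) (ts : List Tm) :
    lift d c (func f ts) = func f (ts.map (lift d c)) := by
  simp [lift]

theorem subst_func (k : ℕ) (m : Tm) (f : ℕ) (ts : List Tm) :
    subst k m (func f ts) = func f (ts.map (subst k m)) := by
  simp [subst]

theorem lift_lift (t : Tm) {j c : ℕ} (h : j ≤ c) :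
    (t.lift 1 j).lift 1 (c + 1) = (t.lift 1 c).lift 1 j := by
  induction t using induction_on_mem with
  | var i => grind [lift]
  | const k => simp [lift]
  | func f ts ih => simpa [lift_func] using ih

theorem subst_lift_cancel (t m : Tm) (k : ℕ) : subst k m (t.lift 1 k) = t := by
  induction t using induction_on_mem with
  | var i => grind [lift, subst]
  | const k => simp [lift, subst]
  | func f ts ih => simpa [lift_func, subst_func, Function.comp_def] using
    (List.map_congr_left ih).trans (List.map_id ts)

theorem lift_subst (t m : Tm) {j c : ℕ} (h : j ≤ c) :
    (subst j m t).lift 1 c = subst j (m.lift 1 c) (t.lift 1 (c + 1)) := by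
  induction t using induction_on_mem with
  | var i => grind [lift, subst]
  | const k => simp [lift, subst]
  | func f ts ih => simpa [lift_func, subst_func] using ih

theorem subst_lift (t m : Tm) {j k : ℕ} (h : j ≤ k) :
    subst (k + 1) (m.lift 1 j) (t.lift 1 j) = (subst k m t).lift 1 j := by
  induction t using induction_on_mem with
  | var i => grind [lift, subst]
  | const k => simp [lift, subst]
  | func f ts ih => simpa [lift_func, subst_func] using ih

theorem subst_subst (t n m : Tm) {j k : ℕ} (h : j ≤ k) :
    subst k m (subst j n t) = subst j (subst k m n) (subst (k + 1) (m.lift 1 j) t) := by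
  induction t using induction_on_mem with
  | var i => grind [subst, subst_lift_cancel]
  | const k => simp [subst]
  | func f ts ih => simpa [subst_func] using ih

end Tm

namespace Fml

theorem lift_lift (A : Fml) {j c : ℕ} (h : j ≤ c) :
    (A.lift 1 j).lift 1 (c + 1) = (A.lift 1 c).lift 1 j := by
  induction A generalizing j c with
  | atom P ts => simp [lift, Tm.lift_lift _ h]
  | bot => rfl
  | _ => simp_all [lift]

theorem subst_lift_cancel (A : Fml) (m : Tm) (k : ℕ) : (A.lift 1 k).subst k m = A := by
  induction A generalizing m k with
  | atom P ts => simpa [lift, subst, Function.comp_def] using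
    List.map_id'' (fun t => Tm.subst_lift_cancel t m k) ts
  | bot => rfl
  | _ => simp_all [lift, subst]

theorem lift_subst (A : Fml) (m : Tm) {j c : ℕ} (h : j ≤ c) :
    (A.subst j m).lift 1 c = (A.lift 1 (c + 1)).subst j (m.lift 1 c) := by
  induction A generalizing m j c with
  | atom P ts => simp [lift, subst, Tm.lift_subst _ _ h]
  | bot => rfl
  | _ => simp_all [lift, subst, Tm.lift_lift]

theorem subst_lift (A : Fml) (m : Tm) {j k : ℕ} (h : j ≤ k) :
    (A.lift 1 j).subst (k + 1) (m.lift 1 j) = (A.subst k m).lift 1 j := by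
  induction A generalizing m j k with
  | atom P ts => simp [lift, subst, Tm.subst_lift _ _ h]
  | bot => rfl
  | all A ih | ex A ih =>
    simp only [lift, subst, ← Tm.lift_lift m (Nat.zero_le j), ih _ (Nat.succ_le_succ h)]
  | _ => simp_all [lift, subst]

theorem subst_subst (A : Fml) (n m : Tm) {j k : ℕ} (h : j ≤ k) :
    (A.subst j n).subst k m = (A.subst (k + 1) (m.lift 1 j)).subst j (Tm.subst k m n) := by
  induction A generalizing n m j k with
  | atom P ts => simp [subst, Tm.subst_subst _ _ _ h]
  | bot => rfl
  | all A ih | ex A ih =>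
    simp only [subst, ← Tm.lift_lift m (Nat.zero_le j), ih _ _ (Nat.succ_le_succ h),
      Tm.subst_lift _ _ (Nat.zero_le k)]
  | _ => simp_all [subst]

theorem map_lift_lift (Γ : List Fml) (c : ℕ) :
    (Γ.map (lift 1 0)).map (lift 1 (c + 1)) = (Γ.map (lift 1 c)).map (lift 1 0) := by
  simp [lift_lift]

theorem map_subst_lift (Γ : List Fml) (k : ℕ) (m : Tm) :
    (Γ.map (lift 1 0)).map (subst (k + 1) (m.lift 1 0)) =
      (Γ.map (subst k m)).map (lift 1 0) := by
  simp [subst_lift]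

theorem map_subst_lift_cancel (Γ : List Fml) (k : ℕ) (m : Tm) :
    (Γ.map (lift 1 k)).map (subst k m) = Γ := by
  simpa [Function.comp_def] using List.map_id'' (fun A => subst_lift_cancel A m k) Γ

theorem Atomic.lift {P : Fml} (h : P.Atomic) (d c : ℕ) : (P.lift d c).Atomic := by
  cases P <;> simp_all [Atomic, Fml.lift]

theorem Atomic.subst {P : Fml} (h : P.Atomic) (k : ℕ) (m : Tm) : (P.subst k m).Atomic := by
  cases P <;> simp_all [Atomic, Fml.subst]

end Fml

namespace Pf

theorem plift_tlift (t : Pf) (d c d' c' : ℕ) :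
    (t.tlift d c).plift d' c' = (t.plift d' c').tlift d c := by
  induction t generalizing c c' with
  | var n => simp only [tlift, plift]; split_ifs <;> rfl
  | _ => simp_all [tlift, plift]

theorem fvars_tlift (t : Pf) (d c : ℕ) : (t.tlift d c).fvars = t.fvars := by
  induction t generalizing c <;> simp_all [tlift, fvars]

theorem fvars_tsubst (t : Pf) (k : ℕ) (m : Tm) : (t.tsubst k m).fvars = t.fvars := by
  induction t generalizing k m <;> simp_all [tsubst, fvars]

theorem mem_fvars_plift (t : Pf) (c n : ℕ) :
    n ∈ (t.plift 1 c).fvars ↔ n < c ∧ n ∈ t.fvars ∨ c < n ∧ n - 1 ∈ t.fvars := by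
  induction t generalizing c n with
  | var i => simp only [plift]; split_ifs <;> simp [fvars] <;> omega
  | _ =>
    simp only [plift, fvars, Set.mem_union, Set.mem_ofPred_eq, Set.mem_empty_iff_false, *] <;> grind

theorem succ_mem_fvars_plift_zero (t : Pf) (n : ℕ) :
    n + 1 ∈ (t.plift 1 0).fvars ↔ n ∈ t.fvars := by
  simp [mem_fvars_plift]

theorem mem_fvars_of_mem_fvars_psubst (t q : Pf) (k n : ℕ) (h : n ∈ (t.psubst k q).fvars) :
    n ∈ q.fvars ∨ n < k ∧ n ∈ t.fvars ∨ k ≤ n ∧ n + 1 ∈ t.fvars := by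
  induction t generalizing q k n with
  | var i => simp only [psubst] at h; split_ifs at h <;> grind [fvars]
  | _ =>
    simp only [psubst, fvars, Set.mem_union, Set.mem_ofPred_eq, Set.mem_empty_iff_false] at h ⊢ <;>
    grind [fvars_tlift, succ_mem_fvars_plift_zero]

theorem fvars_psubst_zero_subset (t q : Pf) :
    (t.psubst 0 q).fvars ⊆ {n | n + 1 ∈ t.fvars} ∪ q.fvars := by
  intro n hn
  have := mem_fvars_of_mem_fvars_psubst t q 0 n hn
  simp at this ⊢
  tauto

end Pf

theorem Step.fvars_subset {t u : Pf} (h : Step t u) : u.fvars ⊆ t.fvars := by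
  induction h with
  | beta => exact Pf.fvars_psubst_zero_subset _ _
  | qbeta => simp [Pf.fvars, Pf.fvars_tsubst]
  | @projPair _ _ b => cases b <;> simp [Pf.fvars]
  | @caseInj b u w₁ w₂ =>
    have h₁ := Pf.fvars_psubst_zero_subset w₁ u
    have h₂ := Pf.fvars_psubst_zero_subset w₂ u
    cases b <;> grind [Pf.fvars]
  | @edestPair m u v =>
    have h := Pf.fvars_psubst_zero_subset (v.tsubst 0 m) u
    rw [Pf.fvars_tsubst] at h
    grind [Pf.fvars]
  | DinjL => simp [Pf.fvars]
  | DinjR => simp [Pf.fvars, Pf.fvars_tsubst]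
  | _ => grind [Pf.fvars]

namespace Typed

theorem plift {Δ Γ : List Fml} {t : Pf} {A : Fml} (B : Fml) (h : Typed (Δ ++ Γ) t A) :
    Typed (Δ ++ B :: Γ) (t.plift 1 Δ.length) A := by
  generalize hΞ : Δ ++ Γ = Ξ at h
  induction h generalizing Δ Γ B with
  | var h =>
    subst hΞ
    simp only [Pf.plift]
    split_ifs <;> exact .var (by grind)
  | pair _ _ ih₁ ih₂ => exact .pair (ih₁ B hΞ) (ih₂ B hΞ)
  | projL _ ih => exact .projL (ih B hΞ)
  | projR _ ih => exact .projR (ih B hΞ)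
  | lam _ ih => exact .lam (ih (Δ := _ :: Δ) B (by simp [hΞ]))
  | app _ _ ih₁ ih₂ => exact .app (ih₁ B hΞ) (ih₂ B hΞ)
  | injL _ ih => exact .injL (ih B hΞ)
  | injR _ ih => exact .injR (ih B hΞ)
  | case _ _ _ ih ih₁ ih₂ =>
    exact .case (ih B hΞ) (ih₁ (Δ := _ :: Δ) B (by simp [hΞ]))
      (ih₂ (Δ := _ :: Δ) B (by simp [hΞ]))
  | qlam _ ih =>
    have := ih (Δ := Δ.map (Fml.lift 1 0)) (Γ := Γ.map (Fml.lift 1 0)) (B.lift 1 0)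
      (by simp [← hΞ])
    exact .qlam (by simpa using this)
  | qapp m _ ih => exact .qapp m (ih B hΞ)
  | epair m _ ih => exact .epair m (ih B hΞ)
  | @edest _ _ _ A _ _ _ ih₁ ih₂ =>
    have := ih₂ (Δ := A :: Δ.map (Fml.lift 1 0)) (Γ := Γ.map (Fml.lift 1 0)) (B.lift 1 0)
      (by simp [← hΞ])
    exact .edest (ih₁ B hΞ) (by simpa using this)
  | efq _ hP ih => exact .efq (ih B hΞ) hP
  | D => exact .D

theorem tlift {Γ : List Fml} {t : Pf} {A : Fml} (h : Typed Γ t A) (c : ℕ) :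
    Typed (Γ.map (Fml.lift 1 c)) (t.tlift 1 c) (A.lift 1 c) := by
  induction h generalizing c with
  | var h => exact .var (by simp [h])
  | pair _ _ ih₁ ih₂ => exact .pair (ih₁ c) (ih₂ c)
  | projL _ ih => exact .projL (ih c)
  | projR _ ih => exact .projR (ih c)
  | lam _ ih => exact .lam (ih c)
  | app _ _ ih₁ ih₂ => exact .app (ih₁ c) (ih₂ c)
  | injL _ ih => exact .injL (ih c)
  | injR _ ih => exact .injR (ih c)
  | case _ _ _ ih ih₁ ih₂ => exact .case (ih c) (ih₁ c) (ih₂ c)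
  | qlam _ ih => exact .qlam (Fml.map_lift_lift _ c ▸ ih (c + 1))
  | qapp m _ ih =>
    rw [Fml.lift_subst _ _ (Nat.zero_le c)]
    exact .qapp _ (ih c)
  | epair m _ ih => exact .epair _ (Fml.lift_subst _ _ (Nat.zero_le c) ▸ ih c)
  | edest _ _ ih₁ ih₂ =>
    have := ih₂ (c + 1)
    rw [List.map_cons, Fml.map_lift_lift, Fml.lift_lift _ (Nat.zero_le c)] at this
    exact .edest (ih₁ c) this
  | efq _ hP ih => exact .efq (ih c) (hP.lift 1 c)
  | @D _ A B =>
    simp only [Fml.lift, Fml.lift_lift B (Nat.zero_le c)]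
    exact .D

theorem tsubst {Γ : List Fml} {t : Pf} {A : Fml} (h : Typed Γ t A) (k : ℕ) (m : Tm) :
    Typed (Γ.map (Fml.subst k m)) (t.tsubst k m) (A.subst k m) := by
  induction h generalizing k m with
  | var h => exact .var (by simp [h])
  | pair _ _ ih₁ ih₂ => exact .pair (ih₁ k m) (ih₂ k m)
  | projL _ ih => exact .projL (ih k m)
  | projR _ ih => exact .projR (ih k m)
  | lam _ ih => exact .lam (ih k m)
  | app _ _ ih₁ ih₂ => exact .app (ih₁ k m) (ih₂ k m)
  | injL _ ih => exact .injL (ih k m)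
  | injR _ ih => exact .injR (ih k m)
  | case _ _ _ ih ih₁ ih₂ => exact .case (ih k m) (ih₁ k m) (ih₂ k m)
  | qlam _ ih => exact .qlam (Fml.map_subst_lift _ k m ▸ ih (k + 1) (m.lift 1 0))
  | qapp n _ ih =>
    rw [Fml.subst_subst _ _ _ (Nat.zero_le k)]
    exact .qapp _ (ih k m)
  | epair n _ ih => exact .epair _ (Fml.subst_subst _ _ _ (Nat.zero_le k) ▸ ih k m)
  | edest _ _ ih₁ ih₂ =>
    have := ih₂ (k + 1) (m.lift 1 0)
    rw [List.map_cons, Fml.map_subst_lift, Fml.subst_lift _ _ (Nat.zero_le k)] at this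
    exact .edest (ih₁ k m) this
  | efq _ hP ih => exact .efq (ih k m) (hP.subst k m)
  | @D _ A B =>
    simp only [Fml.subst, Fml.subst_lift B _ (Nat.zero_le k)]
    exact .D

theorem psubst {Δ Γ : List Fml} {t q : Pf} {A B : Fml} (h : Typed (Δ ++ B :: Γ) t A)
    (hq : Typed (Δ ++ Γ) q B) : Typed (Δ ++ Γ) (t.psubst Δ.length q) A := by
  generalize hΞ : Δ ++ B :: Γ = Ξ at h
  induction h generalizing Δ Γ B q with
  | @var _ n _ h =>
    subst hΞ
    simp only [Pf.psubst]
    split_ifs with h₁ h₂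
    · subst h₁
      simp at h
      exact h ▸ hq
    · exact .var (by grind)
    · exact .var (by grind)
  | pair _ _ ih₁ ih₂ => exact .pair (ih₁ hq hΞ) (ih₂ hq hΞ)
  | projL _ ih => exact .projL (ih hq hΞ)
  | projR _ ih => exact .projR (ih hq hΞ)
  | lam _ ih => exact .lam (ih (Δ := _ :: Δ) (hq.plift (Δ := []) _) (by simp [hΞ]))
  | app _ _ ih₁ ih₂ => exact .app (ih₁ hq hΞ) (ih₂ hq hΞ)
  | injL _ ih => exact .injL (ih hq hΞ)
  | injR _ ih => exact .injR (ih hq hΞ)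
  | case _ _ _ ih ih₁ ih₂ =>
    exact .case (ih hq hΞ) (ih₁ (Δ := _ :: Δ) (hq.plift (Δ := []) _) (by simp [hΞ]))
      (ih₂ (Δ := _ :: Δ) (hq.plift (Δ := []) _) (by simp [hΞ]))
  | qlam _ ih =>
    have := ih (Δ := Δ.map (Fml.lift 1 0)) (Γ := Γ.map (Fml.lift 1 0))
      (by simpa using hq.tlift 0) (by simp [← hΞ])
    exact .qlam (by simpa using this)
  | qapp m _ ih => exact .qapp m (ih hq hΞ)
  | epair m _ ih => exact .epair m (ih hq hΞ)
  | @edest _ _ _ A _ _ _ ih₁ ih₂ =>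
    have hq' := (hq.tlift 0).plift (Δ := []) A
    have := ih₂ (Δ := A :: Δ.map (Fml.lift 1 0)) (Γ := Γ.map (Fml.lift 1 0))
      (by simpa using hq') (by simp [← hΞ])
    exact .edest (ih₁ hq hΞ) (by simpa [Pf.plift_tlift] using this)
  | efq _ hP ih => exact .efq (ih hq hΞ) hP
  | D => exact .D

theorem psubst_zero {Γ : List Fml} {t q : Pf} {A B : Fml} (h : Typed (B :: Γ) t A)
    (hq : Typed Γ q B) : Typed Γ (t.psubst 0 q) A :=
  psubst (Δ := []) h hq

theorem tsubst_zero {Γ : List Fml} {t : Pf} {A : Fml} (h : Typed (Γ.map (Fml.lift 1 0)) t A)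
    (m : Tm) : Typed Γ (t.tsubst 0 m) (A.subst 0 m) :=
  Fml.map_subst_lift_cancel Γ 0 m ▸ h.tsubst 0 m

theorem edest_epair {Γ : List Fml} {u v : Pf} {A C : Fml} {m : Tm}
    (hu : Typed Γ u (A.subst 0 m))
    (hv : Typed (A :: Γ.map (Fml.lift 1 0)) v (C.lift 1 0)) :
    Typed Γ ((v.tsubst 0 m).psubst 0 u) C := by
  have := hv.tsubst 0 m
  rw [List.map_cons, Fml.map_subst_lift_cancel, Fml.subst_lift_cancel] at this
  exact this.psubst_zero hu

theorem step {Γ : List Fml} {t u : Pf} {C : Fml} (ht : Typed Γ t C) (h : Step t u) :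
    Typed Γ u C := by
  induction h generalizing Γ C with
  | beta =>
    cases ht with | app h hu => cases h with | lam h => exact h.psubst_zero hu
  | qbeta =>
    cases ht with | qapp _ h => cases h with | qlam h => exact h.tsubst_zero _
  | projPair =>
    cases ht with
    | projL h => cases h with | pair h₁ h₂ => exact h₁
    | projR h => cases h with | pair h₁ h₂ => exact h₂
  | caseInj =>
    cases ht with
    | case h h₁ h₂ =>
      cases h with
      | injL h => exact h₁.psubst_zero h
      | injR h => exact h₂.psubst_zero h
  | edestPair =>
    cases ht with | edest h hv => cases h with | epair _ h => exact edest_epair h hv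
  | DinjL =>
    cases ht with
    | app hD h => cases hD; cases h with | qlam h => cases h with | injL h => exact .injL (.qlam h)
  | DinjR =>
    cases ht with
    | app hD h =>
      cases hD
      cases h with
      | qlam h =>
        cases h with
        | injR h =>
          have := h.tsubst_zero (.const 0)
          rw [Fml.subst_lift_cancel] at this
          exact .injR this
  | pairL _ ih => cases ht with | pair h₁ h₂ => exact .pair (ih h₁) h₂
  | pairR _ ih => cases ht with | pair h₁ h₂ => exact .pair h₁ (ih h₂)
  | projC _ ih =>
    cases ht with
    | projL h => exact .projL (ih h)
    | projR h => exact .projR (ih h)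
  | lamC _ ih => cases ht with | lam h => exact .lam (ih h)
  | appL _ ih => cases ht with | app h₁ h₂ => exact .app (ih h₁) h₂
  | appR _ ih => cases ht with | app h₁ h₂ => exact .app h₁ (ih h₂)
  | injC _ ih =>
    cases ht with
    | injL h => exact .injL (ih h)
    | injR h => exact .injR (ih h)
  | caseU _ ih => cases ht with | case h h₁ h₂ => exact .case (ih h) h₁ h₂
  | caseL _ ih => cases ht with | case h h₁ h₂ => exact .case h (ih h₁) h₂
  | caseR _ ih => cases ht with | case h h₁ h₂ => exact .case h h₁ (ih h₂)
  | qlamC _ ih => cases ht with | qlam h => exact .qlam (ih h)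
  | qappC _ ih => cases ht with | qapp _ h => exact .qapp _ (ih h)
  | epairC _ ih => cases ht with | epair _ h => exact .epair _ (ih h)
  | edestL _ ih => cases ht with | edest h₁ h₂ => exact .edest (ih h₁) h₂
  | edestR _ ih => cases ht with | edest h₁ h₂ => exact .edest h₁ (ih h₂)
  | efqC _ ih => cases ht with | efq h hP => exact .efq (ih h) hP

end Typed

/-- **Subject Reduction for CD**: if `t : C` is derivable from the context `Γ`
and `t ↦ u`, then `u : C` is derivable from the same context; moreover the
free proof-term variables of `u` are among those of `t`. -/
theorem subject_reduction {Γ : List Fml} {t u : Pf} {C : Fml}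
    (ht : Typed Γ t C) (hstep : Step t u) :
    Typed Γ u C ∧ u.fvars ⊆ t.fvars :=
  ⟨ht.step hstep, hstep.fvars_subset⟩
end

section
/- Witness property for normal proofs in CD: if t is a closed proof term in normal form with CD ⊢ t : ∃α A, then t = (m, u) for some first-order term m and some proof term u with CD ⊢ u : A[m/α]. -/
/-- The canonical shapes of closed normal proof terms of a given type: proofs of a universal
formula are first-order abstractions whose body is again canonical, and `⊥` and the other atomic
formulas have no canonical proofs. -/
def CanonicalForm : Fml → Pf → Prop
  | .atom _ _, _ => False
  | .bot, _ => False
  | .conj _ _, t => ∃ u v, t = .pair u v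
  | .disj _ _, t => ∃ b u, t = .inj b u
  | .impl C _, t => (∃ u, t = .lam C u) ∨
      ∃ A B, t = .D A B ∧ C = .all (.disj A (B.lift 1 0))
  | .all A, t => ∃ u, t = .qlam u ∧ CanonicalForm A u
  | .ex _, t => ∃ m u, t = .epair m u

/-- Closed normal proof terms are canonical. -/
theorem Typed.canonicalForm {t : Pf} {A : Fml} (hty : Typed [] t A) (hnf : NormalForm t) :
    CanonicalForm A t := by
  generalize hΓ : ([] : List Fml) = Γ at hty
  induction hty with
  | var h => subst hΓ; simp at h
  | pair => exact ⟨_, _, rfl⟩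
  | projL _ ih =>
    obtain ⟨u, v, rfl⟩ := ih (fun _ hs => hnf _ (.projC hs)) hΓ
    exact (hnf _ .projPair).elim
  | projR _ ih =>
    obtain ⟨u, v, rfl⟩ := ih (fun _ hs => hnf _ (.projC hs)) hΓ
    exact (hnf _ .projPair).elim
  | lam => exact Or.inl ⟨_, rfl⟩
  | app _ _ ihf iha =>
    rcases ihf (fun _ hs => hnf _ (.appL hs)) hΓ with ⟨u, rfl⟩ | ⟨A, B, rfl, rfl⟩
    · exact (hnf _ .beta).elim
    · obtain ⟨_, rfl, b, u, rfl⟩ := iha (fun _ hs => hnf _ (.appR hs)) hΓ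
      cases b
      · exact (hnf _ .DinjL).elim
      · exact (hnf _ .DinjR).elim
  | injL => exact ⟨_, _, rfl⟩
  | injR => exact ⟨_, _, rfl⟩
  | case _ _ _ ih =>
    obtain ⟨b, u, rfl⟩ := ih (fun _ hs => hnf _ (.caseU hs)) hΓ
    exact (hnf _ .caseInj).elim
  | qlam _ ih => exact ⟨_, rfl, ih (fun _ hs => hnf _ (.qlamC hs)) (by simp [← hΓ])⟩
  | qapp _ _ ih =>
    obtain ⟨u, rfl, -⟩ := ih (fun _ hs => hnf _ (.qappC hs)) hΓ
    exact (hnf _ .qbeta).elim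
  | epair => exact ⟨_, _, rfl⟩
  | edest _ _ ih =>
    obtain ⟨m, u, rfl⟩ := ih (fun _ hs => hnf _ (.edestL hs)) hΓ
    exact (hnf _ .edestPair).elim
  | efq _ _ ih => exact (ih (fun _ hs => hnf _ (.efqC hs)) hΓ).elim
  | D => exact Or.inr ⟨_, _, rfl, rfl⟩

/-- **Witness property for normal proofs in CD**: a closed normal proof term
`t` with `CD ⊢ t : ∃α A` is an existential pair `(m, u)` with
`CD ⊢ u : A[m/α]`. -/
theorem witness_property_normal {t : Pf} {A : Fml}
    (hty : Typed [] t (.ex A)) (hnf : NormalForm t) (hcl : t.fvars = ∅) :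
    ∃ (m : Tm) (u : Pf), t = .epair m u ∧ Typed [] u (A.subst 0 m) := by
  obtain ⟨m, u, rfl⟩ := hty.canonicalForm hnf
  cases hty with
  | epair _ hu => exact ⟨m, u, rfl, hu⟩
end

section
/- Disjunction property for normal proofs in CD: if t is a closed proof term in normal form with CD ⊢ t : A ∨ B, then either t = ι0(u) with CD ⊢ u : A, or t = ι1(u) with CD ⊢ u : B. -/
/-- Hereditary introduction forms: a term that is an introduction or the constant `D`, where the
body of a first-order abstraction is required to be of this form again. -/
inductive IntroForm : Pf → Prop where
  | pair (u t : Pf) : IntroForm (.pair u t)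
  | lam (A : Fml) (u : Pf) : IntroForm (.lam A u)
  | inj (b : Bool) (u : Pf) : IntroForm (.inj b u)
  | qlam {u : Pf} : IntroForm u → IntroForm (.qlam u)
  | epair (m : Tm) (u : Pf) : IntroForm (.epair m u)
  | D (A B : Fml) : IntroForm (.D A B)

/-- A normal proof term without open assumptions is a hereditary introduction form. -/
theorem Typed.introForm_of_normalForm {t : Pf} {A : Fml} (hty : Typed [] t A)
    (hnf : NormalForm t) : IntroForm t := by
  generalize hΓ : ([] : List Fml) = Γ at hty
  induction hty with
  | var h => subst hΓ; simp at h
  | pair => exact .pair _ _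
  | lam => exact .lam _ _
  | injL | injR => exact .inj _ _
  | epair => exact .epair _ _
  | D => exact .D _ _
  | qlam _ ih => subst hΓ; exact .qlam (ih (fun v h => hnf _ (.qlamC h)) rfl)
  | projL h ih | projR h ih =>
    have hi := ih (fun v h => hnf _ (.projC h)) hΓ
    cases hi <;> cases h
    exact absurd .projPair (hnf _)
  | case h _ _ ih =>
    have hi := ih (fun v h => hnf _ (.caseU h)) hΓ
    cases hi <;> cases h <;> exact absurd .caseInj (hnf _)
  | qapp m h ih =>
    have hi := ih (fun v h => hnf _ (.qappC h)) hΓ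
    cases hi <;> cases h
    exact absurd .qbeta (hnf _)
  | edest h _ ih =>
    have hi := ih (fun v h => hnf _ (.edestL h)) hΓ
    cases hi <;> cases h
    exact absurd .edestPair (hnf _)
  | efq h _ ih =>
    have hi := ih (fun v h => hnf _ (.efqC h)) hΓ
    cases hi <;> cases h
  | app h h' ih ih' =>
    have hi := ih (fun v h => hnf _ (.appL h)) hΓ
    have hi' := ih' (fun v h => hnf _ (.appR h)) hΓ
    cases hi <;> cases h
    · exact absurd .beta (hnf _)
    · cases hi' <;> cases h'
      rename_i hb hbody
      cases hb <;> cases hbody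
      · exact absurd .DinjL (hnf _)
      · exact absurd .DinjR (hnf _)

/-- **Disjunction property for normal proofs in CD**: a closed normal proof
term `t` with `CD ⊢ t : A ∨ B` is either `ι₀(u)` with `CD ⊢ u : A` or
`ι₁(u)` with `CD ⊢ u : B`. -/
theorem disjunction_property_normal {t : Pf} {A B : Fml}
    (hty : Typed [] t (.disj A B)) (hnf : NormalForm t) (hcl : t.fvars = ∅) :
    (∃ u : Pf, t = .inj false u ∧ Typed [] u A) ∨
    (∃ u : Pf, t = .inj true u ∧ Typed [] u B) := by
  have hi := hty.introForm_of_normalForm hnf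
  cases hi <;> cases hty
  · exact .inl ⟨_, rfl, ‹_›⟩
  · exact .inr ⟨_, rfl, ‹_›⟩
end

section
/- Universal introduction form for normal proofs in CD: if t is a closed proof term in normal form with CD ⊢ t : ∀α A, then t = λα u for some proof term u with CD ⊢ u : A. -/
/-- A proof term has the introduction form prescribed by the outermost connective of a formula.
The formulas `⊥` and `P(m₁, …, mₙ)` have no introduction form. -/
def IntroForm_s4 : Pf → Fml → Prop
  | _, .atom _ _ => False
  | _, .bot => False
  | t, .conj _ _ => ∃ u v, t = .pair u v
  | t, .disj _ _ => ∃ b u, t = .inj b u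
  | t, .impl _ _ => (∃ A u, t = .lam A u) ∨ ∃ A B, t = .D A B
  | t, .all _ => ∃ u, t = .qlam u
  | t, .ex _ => ∃ m u, t = .epair m u

/-- A normal proof term typed in the empty context is in introduction form. -/
theorem Typed.introForm : ∀ {t : Pf} {C : Fml}, Typed [] t C → NormalForm t → IntroForm_s4 t C
  | .var _, _, .var h, _ => by simp at h
  | .pair _ _, _, .pair _ _, _ => ⟨_, _, rfl⟩
  | .lam _ _, _, .lam _, _ => .inl ⟨_, _, rfl⟩
  | .inj _ _, _, .injL _, _ => ⟨_, _, rfl⟩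
  | .inj _ _, _, .injR _, _ => ⟨_, _, rfl⟩
  | .qlam _, _, .qlam _, _ => ⟨_, rfl⟩
  | .epair _ _, _, .epair _ _, _ => ⟨_, _, rfl⟩
  | .D _ _, _, .D, _ => .inr ⟨_, _, rfl⟩
  | .proj _ _, _, .projL h, hn => by
    obtain ⟨_, _, rfl⟩ := h.introForm fun _ s => hn _ (.projC s)
    exact (hn _ .projPair).elim
  | .proj _ _, _, .projR h, hn => by
    obtain ⟨_, _, rfl⟩ := h.introForm fun _ s => hn _ (.projC s)
    exact (hn _ .projPair).elim
  | .case _ _ _, _, .case h _ _, hn => by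
    obtain ⟨_, _, rfl⟩ := h.introForm fun _ s => hn _ (.caseU s)
    exact (hn _ .caseInj).elim
  | .qapp _ _, _, .qapp _ h, hn => by
    obtain ⟨_, rfl⟩ := h.introForm fun _ s => hn _ (.qappC s)
    exact (hn _ .qbeta).elim
  | .edest _ _, _, .edest h _, hn => by
    obtain ⟨_, _, rfl⟩ := h.introForm fun _ s => hn _ (.edestL s)
    exact (hn _ .edestPair).elim
  | .efq _ _, _, .efq h _, hn => (h.introForm fun _ s => hn _ (.efqC s)).elim
  | .app _ _, _, .app h h', hn => by
    obtain ⟨_, _, rfl⟩ | ⟨_, _, rfl⟩ := h.introForm fun _ s => hn _ (.appL s)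
    · exact (hn _ .beta).elim
    · cases h
      obtain ⟨_, rfl⟩ := h'.introForm fun _ s => hn _ (.appR s)
      cases h' with
      | qlam h' =>
        obtain ⟨b, _, rfl⟩ := h'.introForm fun _ s => hn _ (.appR (.qlamC s))
        cases b
        · exact (hn _ .DinjL).elim
        · exact (hn _ .DinjR).elim
termination_by t => sizeOf t
decreasing_by all_goals (subst_vars; simp; try omega)

/-- **Universal introduction form for normal proofs in CD**: a closed normal
proof term `t` with `CD ⊢ t : ∀α A` is an abstraction `λα u` with
`CD ⊢ u : A`. -/
theorem forall_intro_form_normal {t : Pf} {A : Fml}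
    (hty : Typed [] t (.all A)) (hnf : NormalForm t) (hcl : t.fvars = ∅) :
    ∃ u : Pf, t = .qlam u ∧ Typed [] u A := by
  obtain ⟨u, rfl⟩ := hty.introForm hnf
  cases hty with
  | qlam h => exact ⟨u, rfl, h⟩
end

section
/- Strong normalization for CD: if t : A is derivable in CD, then t is strongly normalizable with respect to the one-step reduction relation ↦, i.e. there is no infinite reduction sequence t ↦ t1 ↦ t2 ↦ ⋯ starting from t. -/
/-! Strong normalization by erasing all first-order information and running a
reducibility argument on the erased terms.  Every reduction step is preserved by
the erasure, and the reducibility predicate of a formula is invariant under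
first-order substitution. -/

/-- Proof terms without first-order information.  Existential pairs and
eliminations are represented by injections and case distinctions. -/
inductive ErasedPf : Type where
  | var : ℕ → ErasedPf
  | pair : ErasedPf → ErasedPf → ErasedPf
  | proj : Bool → ErasedPf → ErasedPf
  | lam : ErasedPf → ErasedPf
  | app : ErasedPf → ErasedPf → ErasedPf
  | inj : Bool → ErasedPf → ErasedPf
  | case : ErasedPf → ErasedPf → ErasedPf → ErasedPf
  | qlam : ErasedPf → ErasedPf
  | qapp : ErasedPf → ErasedPf
  | efq : ErasedPf → ErasedPf
  | D : ErasedPf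

namespace ErasedPf

/-- Extend a renaming under a binder. -/
def upRen (ξ : ℕ → ℕ) : ℕ → ℕ
  | 0 => 0
  | n + 1 => ξ n + 1

/-- Rename the free variables. -/
def rename : (ℕ → ℕ) → ErasedPf → ErasedPf
  | ξ, var n => var (ξ n)
  | ξ, pair u t => pair (rename ξ u) (rename ξ t)
  | ξ, proj b u => proj b (rename ξ u)
  | ξ, lam u => lam (rename (upRen ξ) u)
  | ξ, app u t => app (rename ξ u) (rename ξ t)
  | ξ, inj b u => inj b (rename ξ u)
  | ξ, case u v w => case (rename ξ u) (rename (upRen ξ) v) (rename (upRen ξ) w)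
  | ξ, qlam u => qlam (rename ξ u)
  | ξ, qapp u => qapp (rename ξ u)
  | ξ, efq u => efq (rename ξ u)
  | _, D => D

/-- Extend a substitution under a binder. -/
def up (σ : ℕ → ErasedPf) : ℕ → ErasedPf
  | 0 => var 0
  | n + 1 => rename Nat.succ (σ n)

/-- Parallel substitution. -/
def subst : (ℕ → ErasedPf) → ErasedPf → ErasedPf
  | σ, var n => σ n
  | σ, pair u t => pair (subst σ u) (subst σ t)
  | σ, proj b u => proj b (subst σ u)
  | σ, lam u => lam (subst (up σ) u)
  | σ, app u t => app (subst σ u) (subst σ t)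
  | σ, inj b u => inj b (subst σ u)
  | σ, case u v w => case (subst σ u) (subst (up σ) v) (subst (up σ) w)
  | σ, qlam u => qlam (subst σ u)
  | σ, qapp u => qapp (subst σ u)
  | σ, efq u => efq (subst σ u)
  | _, D => D

/-- Prepend a term to a substitution. -/
def cons (q : ErasedPf) (σ : ℕ → ErasedPf) : ℕ → ErasedPf
  | 0 => q
  | n + 1 => σ n

/-- Substitute `q` for the variable `0`. -/
abbrev inst (t q : ErasedPf) : ErasedPf := subst (cons q var) t

theorem upRen_comp (ξ ζ : ℕ → ℕ) : upRen ζ ∘ upRen ξ = upRen (ζ ∘ ξ) := by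
  funext n; cases n <;> rfl

theorem rename_rename (t : ErasedPf) (ξ ζ : ℕ → ℕ) :
    rename ζ (rename ξ t) = rename (ζ ∘ ξ) t := by
  induction t generalizing ξ ζ <;> simp_all [rename, upRen_comp]

theorem up_comp_upRen (σ : ℕ → ErasedPf) (ξ : ℕ → ℕ) : up σ ∘ upRen ξ = up (σ ∘ ξ) := by
  funext n; cases n <;> rfl

theorem subst_rename (t : ErasedPf) (σ : ℕ → ErasedPf) (ξ : ℕ → ℕ) :
    subst σ (rename ξ t) = subst (σ ∘ ξ) t := by
  induction t generalizing σ ξ <;> simp_all [rename, subst, up_comp_upRen]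

theorem rename_upRen_comp_up (σ : ℕ → ErasedPf) (ξ : ℕ → ℕ) :
    rename (upRen ξ) ∘ up σ = up (rename ξ ∘ σ) := by
  funext n
  cases n with
  | zero => rfl
  | succ n =>
    simp only [Function.comp, up, rename_rename]
    rfl

theorem rename_subst (t : ErasedPf) (σ : ℕ → ErasedPf) (ξ : ℕ → ℕ) :
    rename ξ (subst σ t) = subst (rename ξ ∘ σ) t := by
  induction t generalizing σ ξ <;> simp_all [rename, subst, rename_upRen_comp_up]

theorem subst_up_comp_up (σ τ : ℕ → ErasedPf) : subst (up τ) ∘ up σ = up (subst τ ∘ σ) := by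
  funext n
  cases n with
  | zero => rfl
  | succ n =>
    simp only [Function.comp, up, rename_subst, subst_rename]
    rfl

theorem subst_subst (t : ErasedPf) (σ τ : ℕ → ErasedPf) :
    subst τ (subst σ t) = subst (subst τ ∘ σ) t := by
  induction t generalizing σ τ <;> simp_all [subst, subst_up_comp_up]

theorem up_var : up var = var := by
  funext n; cases n <;> rfl

theorem subst_var (t : ErasedPf) : subst var t = t := by
  induction t <;> simp_all [subst, up_var]

theorem inst_subst_up (t q : ErasedPf) (σ : ℕ → ErasedPf) :
    inst (subst (up σ) t) q = subst (cons q σ) t := by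
  rw [inst, subst_subst]
  congr 1
  funext n
  cases n with
  | zero => rfl
  | succ n =>
    simp only [Function.comp, up, subst_rename]
    exact subst_var _

theorem subst_inst (t q : ErasedPf) (σ : ℕ → ErasedPf) :
    subst σ (inst t q) = inst (subst (up σ) t) (subst σ q) := by
  rw [inst_subst_up, inst, subst_subst]
  congr 1
  funext n
  cases n <;> rfl

/-- One-step reduction of erased terms. -/
inductive Red : ErasedPf → ErasedPf → Prop where
  | beta {u t} : Red (app (lam u) t) (inst u t)
  | qbeta {u} : Red (qapp (qlam u)) u
  | projPair {u t b} : Red (proj b (pair u t)) (if b then t else u)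
  | caseInj {b u v w} : Red (case (inj b u) v w) (inst (if b then w else v) u)
  | DinjL {u} : Red (app D (qlam (inj false u))) (inj false (qlam u))
  | DinjR {u} : Red (app D (qlam (inj true u))) (inj true u)
  | pairL {u u' t} : Red u u' → Red (pair u t) (pair u' t)
  | pairR {u t t'} : Red t t' → Red (pair u t) (pair u t')
  | projC {b u u'} : Red u u' → Red (proj b u) (proj b u')
  | lamC {u u'} : Red u u' → Red (lam u) (lam u')
  | appL {u u' t} : Red u u' → Red (app u t) (app u' t)
  | appR {u t t'} : Red t t' → Red (app u t) (app u t')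
  | injC {b u u'} : Red u u' → Red (inj b u) (inj b u')
  | caseU {u u' v w} : Red u u' → Red (case u v w) (case u' v w)
  | caseL {u v v' w} : Red v v' → Red (case u v w) (case u v' w)
  | caseR {u v w w'} : Red w w' → Red (case u v w) (case u v w')
  | qlamC {u u'} : Red u u' → Red (qlam u) (qlam u')
  | qappC {u u'} : Red u u' → Red (qapp u) (qapp u')
  | efqC {u u'} : Red u u' → Red (efq u) (efq u')

theorem Red.subst {t t' : ErasedPf} (h : Red t t') (σ : ℕ → ErasedPf) :
    Red (t.subst σ) (t'.subst σ) := by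
  induction h generalizing σ with
  | beta => rw [subst_inst]; exact .beta
  | qbeta => exact .qbeta
  | @projPair u t b => cases b <;> exact .projPair
  | @caseInj b u v w => rw [subst_inst]; cases b <;> exact .caseInj
  | DinjL => exact .DinjL
  | DinjR => exact .DinjR
  | pairL _ ih => exact .pairL (ih σ)
  | pairR _ ih => exact .pairR (ih σ)
  | projC _ ih => exact .projC (ih σ)
  | lamC _ ih => exact .lamC (ih _)
  | appL _ ih => exact .appL (ih σ)
  | appR _ ih => exact .appR (ih σ)
  | injC _ ih => exact .injC (ih σ)
  | caseU _ ih => exact .caseU (ih σ)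
  | caseL _ ih => exact .caseL (ih _)
  | caseR _ ih => exact .caseR (ih _)
  | qlamC _ ih => exact .qlamC (ih σ)
  | qappC _ ih => exact .qappC (ih σ)
  | efqC _ ih => exact .efqC (ih σ)

/-- Strongly normalizing erased terms. -/
abbrev SN (t : ErasedPf) : Prop := Acc (fun a b => Red b a) t

theorem SN.of_map {f : ErasedPf → ErasedPf} (hf : ∀ {t t'}, Red t t' → Red (f t) (f t'))
    {t : ErasedPf} (h : SN (f t)) : SN t := by
  generalize hs : f t = s at h
  induction h generalizing t with
  | intro s _ ih => exact ⟨_, fun t' h => ih (f t') (hs ▸ hf h) rfl⟩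

/-- Terms that create no redex when put in an elimination context. -/
def Neutral : ErasedPf → Prop
  | var _ | proj _ _ | app _ _ | case _ _ _ | qapp _ | efq _ => True
  | _ => False

/-- Reducibility candidates. -/
structure Candidate (P : ErasedPf → Prop) : Prop where
  sn {t} : P t → SN t
  red {t t'} : P t → Red t t' → P t'
  expand {t} : Neutral t → (∀ t', Red t t' → P t') → P t

theorem Candidate.var {P : ErasedPf → Prop} (hP : Candidate P) (n : ℕ) : P (var n) :=
  hP.expand trivial fun _ h => nomatch h

theorem Candidate.sn_of_inst {P Q : ErasedPf → Prop} (hP : Candidate P) (hQ : Candidate Q)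
    {t : ErasedPf} (h : ∀ q, P q → Q (inst t q)) : SN t :=
  SN.of_map (f := fun t => inst t (.var 0)) (fun h => h.subst _) (hQ.sn (h _ (hP.var 0)))

theorem candidate_sn : Candidate SN where
  sn := id
  red h := h.inv
  expand _ h := ⟨_, h⟩

/-- The candidate of a disjunction. -/
def Sum (P Q : ErasedPf → Prop) (t : ErasedPf) : Prop :=
  SN t ∧ ∀ b u, Relation.ReflTransGen Red t (inj b u) → if b then Q u else P u

theorem candidate_sum (P Q : ErasedPf → Prop) : Candidate (Sum P Q) where
  sn h := h.1
  red h hr := ⟨h.1.inv hr, fun b u hs => h.2 b u (.head hr hs)⟩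
  expand {t} hn h := by
    refine ⟨⟨_, fun t' hr => (h t' hr).1⟩, fun b u hs => ?_⟩
    rcases Relation.ReflTransGen.cases_head hs with rfl | ⟨t', hr, hs⟩
    · exact hn.elim
    · exact (h t' hr).2 b u hs

/-- The reducibility predicate of a formula. -/
def Reducible : Fml → ErasedPf → Prop
  | .atom _ _ => SN
  | .bot => SN
  | .conj A B => fun t => Reducible A (proj false t) ∧ Reducible B (proj true t)
  | .disj A B => Sum (Reducible A) (Reducible B)
  | .impl A B => fun t => ∀ u, Reducible A u → Reducible B (app t u)
  | .all A => fun t => Reducible A (qapp t)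
  | .ex A => Sum (Reducible A) SN

theorem reducible_lift (A : Fml) (d c : ℕ) : Reducible (A.lift d c) = Reducible A := by
  induction A generalizing c <;> simp_all [Fml.lift, Reducible]

theorem reducible_subst (A : Fml) (k : ℕ) (m : Tm) :
    Reducible (A.subst k m) = Reducible A := by
  induction A generalizing k m <;> simp_all [Fml.subst, Reducible]

theorem candidate_conj {P Q : ErasedPf → Prop} (hP : Candidate P) (hQ : Candidate Q) :
    Candidate fun t => P (proj false t) ∧ Q (proj true t) where
  sn h := SN.of_map .projC (hP.sn h.1)
  red h hr := ⟨hP.red h.1 (.projC hr), hQ.red h.2 (.projC hr)⟩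
  expand hn h := by
    refine ⟨hP.expand trivial fun s hs => ?_, hQ.expand trivial fun s hs => ?_⟩
    · cases hs with
      | projPair => exact hn.elim
      | projC hr => exact (h _ hr).1
    · cases hs with
      | projPair => exact hn.elim
      | projC hr => exact (h _ hr).2

theorem candidate_impl {P Q : ErasedPf → Prop} (hP : Candidate P) (hQ : Candidate Q) :
    Candidate fun t => ∀ u, P u → Q (app t u) where
  sn h := SN.of_map (f := fun t => app t (.var 0)) .appL (hQ.sn (h _ (hP.var 0)))
  red h hr u hu := hQ.red (h u hu) (.appL hr)
  expand {t} hn h u hu := by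
    have hsn := hP.sn hu
    induction hsn with
    | intro u _ ih =>
      refine hQ.expand trivial fun s hs => ?_
      cases hs with
      | beta | DinjL | DinjR => exact hn.elim
      | appL hr => exact h _ hr u hu
      | appR hr => exact ih _ hr (hP.red hu hr)

theorem candidate_all {P : ErasedPf → Prop} (hP : Candidate P) :
    Candidate fun t => P (qapp t) where
  sn h := SN.of_map .qappC (hP.sn h)
  red h hr := hP.red h (.qappC hr)
  expand hn h := hP.expand trivial fun s hs => by
    cases hs with
    | qbeta => exact hn.elim
    | qappC hr => exact h _ hr

theorem candidate_reducible (A : Fml) : Candidate (Reducible A) := by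
  induction A with
  | atom | bot => exact candidate_sn
  | conj A B hA hB => exact candidate_conj hA hB
  | disj | ex => exact candidate_sum _ _
  | impl A B hA hB => exact candidate_impl hA hB
  | all A hA => exact candidate_all hA

theorem Candidate.proj_pair {P Q R : ErasedPf → Prop} (hP : Candidate P) (hQ : Candidate Q)
    (hR : Candidate R) (b : Bool) (hb : ∀ {u t}, P u → Q t → R (if b then t else u))
    {u t : ErasedPf} (hu : P u) (ht : Q t) : R (proj b (pair u t)) := by
  have hsu := hP.sn hu
  induction hsu generalizing t with
  | intro u _ ihu =>
    have hst := hQ.sn ht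
    induction hst with
    | intro t _ iht =>
      refine hR.expand trivial fun s hs => ?_
      cases hs with
      | projPair => exact hb hu ht
      | projC hr =>
        cases hr with
        | pairL hr => exact ihu _ hr (hP.red hu hr) ht
        | pairR hr => exact iht _ hr (hQ.red ht hr)

theorem Candidate.app_lam {P Q : ErasedPf → Prop} (hP : Candidate P) (hQ : Candidate Q)
    {t u : ErasedPf} (ht : ∀ q, P q → Q (inst t q)) (hu : P u) : Q (app (lam t) u) := by
  have hst := hP.sn_of_inst hQ ht
  induction hst generalizing u with
  | intro t _ iht =>
    have hsu := hP.sn hu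
    induction hsu with
    | intro u _ ihu =>
      refine hQ.expand trivial fun s hs => ?_
      cases hs with
      | beta => exact ht u hu
      | appL hr =>
        cases hr with
        | lamC hr => exact iht _ hr (fun q hq => hQ.red (ht q hq) (hr.subst _)) hu
      | appR hr => exact ihu _ hr (hP.red hu hr)

theorem Candidate.qapp_qlam {P : ErasedPf → Prop} (hP : Candidate P) {t : ErasedPf} (ht : P t) :
    P (qapp (qlam t)) := by
  have hst := hP.sn ht
  induction hst with
  | intro t _ ih =>
    refine hP.expand trivial fun s hs => ?_
    cases hs with
    | qbeta => exact ht
    | qappC hr =>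
      cases hr with
      | qlamC hr => exact ih _ hr (hP.red ht hr)

theorem Candidate.case {P Q R : ErasedPf → Prop} (hP : Candidate P) (hQ : Candidate Q)
    (hR : Candidate R) {u v w : ErasedPf} (hu : Sum P Q u) (hv : ∀ q, P q → R (inst v q))
    (hw : ∀ q, Q q → R (inst w q)) : R (case u v w) := by
  have hsu := hu.1
  induction hsu generalizing v w with
  | intro u _ ihu =>
    have hsv := hP.sn_of_inst hR hv
    induction hsv generalizing w with
    | intro v _ ihv =>
      have hsw := hQ.sn_of_inst hR hw
      induction hsw with
      | intro w _ ihw =>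
        refine hR.expand trivial fun s hs => ?_
        cases hs with
        | @caseInj b =>
          have h := hu.2 _ _ .refl
          cases b with
          | false => exact hv _ h
          | true => exact hw _ h
        | caseU hr => exact ihu _ hr ((candidate_sum P Q).red hu hr) hv hw
        | caseL hr => exact ihv _ hr (fun q hq => hR.red (hv q hq) (hr.subst _)) hw
        | caseR hr => exact ihw _ hr (fun q hq => hR.red (hw q hq) (hr.subst _))

theorem sn_inj {b : Bool} {t : ErasedPf} (h : SN t) : SN (inj b t) := by
  induction h with
  | intro t _ ih =>
    refine ⟨_, fun s hs => ?_⟩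
    cases hs with
    | injC hr => exact ih _ hr

theorem sn_efq {t : ErasedPf} (h : SN t) : SN (efq t) := by
  induction h with
  | intro t _ ih =>
    refine ⟨_, fun s hs => ?_⟩
    cases hs with
    | efqC hr => exact ih _ hr

theorem exists_red_of_inj {b : Bool} {t s : ErasedPf}
    (h : Relation.ReflTransGen Red (inj b t) s) :
    ∃ t', s = inj b t' ∧ Relation.ReflTransGen Red t t' := by
  induction h with
  | refl => exact ⟨t, rfl, .refl⟩
  | tail _ hr ih =>
    obtain ⟨t', rfl, ht'⟩ := ih
    cases hr with
    | injC hr => exact ⟨_, rfl, ht'.tail hr⟩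

theorem Candidate.reds {P : ErasedPf → Prop} (hP : Candidate P) {t t' : ErasedPf} (ht : P t)
    (h : Relation.ReflTransGen Red t t') : P t' := by
  induction h with
  | refl => exact ht
  | tail _ hr ih => exact hP.red ih hr

theorem sum_inj_false {P Q : ErasedPf → Prop} (hP : Candidate P) {t : ErasedPf} (ht : P t) :
    Sum P Q (inj false t) := by
  refine ⟨sn_inj (hP.sn ht), fun b u hs => ?_⟩
  obtain ⟨t', h, hs⟩ := exists_red_of_inj hs
  cases h
  exact hP.reds ht hs

theorem sum_inj_true {P Q : ErasedPf → Prop} (hQ : Candidate Q) {t : ErasedPf} (ht : Q t) :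
    Sum P Q (inj true t) := by
  refine ⟨sn_inj (hQ.sn ht), fun b u hs => ?_⟩
  obtain ⟨t', h, hs⟩ := exists_red_of_inj hs
  cases h
  exact hQ.reds ht hs

theorem sum_app_D {P Q : ErasedPf → Prop} (hP : Candidate P) (hQ : Candidate Q) {t : ErasedPf}
    (ht : Sum P Q (qapp t)) : Sum (fun t => P (qapp t)) Q (app D t) := by
  have hst : SN t := SN.of_map .qappC ht.1
  induction hst with
  | intro t _ ih =>
    refine (candidate_sum _ _).expand trivial fun s hs => ?_
    cases hs with
    | DinjL =>
      exact sum_inj_false (candidate_all hP) (hP.qapp_qlam (ht.2 false _ (.single .qbeta)))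
    | DinjR => exact sum_inj_true hQ (ht.2 true _ (.single .qbeta))
    | appL hr => exact nomatch hr
    | appR hr => exact ih _ hr ((candidate_sum P Q).red ht (.qappC hr))

end ErasedPf

namespace Pf

/-- Erase all first-order information from a proof term. -/
def erase : Pf → ErasedPf
  | var n => .var n
  | pair u t => .pair (erase u) (erase t)
  | proj b u => .proj b (erase u)
  | lam _ u => .lam (erase u)
  | app u t => .app (erase u) (erase t)
  | inj b u => .inj b (erase u)
  | case u v w => .case (erase u) (erase v) (erase w)
  | qlam u => .qlam (erase u)
  | qapp u _ => .qapp (erase u)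
  | epair _ u => .inj false (erase u)
  | edest u v => .case (erase u) (erase v) (.efq (.var 0))
  | efq _ u => .efq (erase u)
  | D _ _ => .D

theorem erase_tlift (t : Pf) (d c : ℕ) : (t.tlift d c).erase = t.erase := by
  induction t generalizing c <;> simp_all [tlift, erase]

theorem erase_tsubst (t : Pf) (k : ℕ) (m : Tm) : (t.tsubst k m).erase = t.erase := by
  induction t generalizing k m <;> simp_all [tsubst, erase]

theorem upRen_ite (d c : ℕ) : ErasedPf.upRen (fun n => if n < c then n else n + d) =
    fun n => if n < c + 1 then n else n + d := by
  funext n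
  cases n with
  | zero => simp [ErasedPf.upRen]
  | succ n =>
    simp only [ErasedPf.upRen]
    split_ifs <;> omega

theorem erase_plift (t : Pf) (d c : ℕ) :
    (t.plift d c).erase = t.erase.rename fun n => if n < c then n else n + d := by
  induction t generalizing c with
  | var n => simp only [plift]; split_ifs with h <;> simp [erase, ErasedPf.rename, h]
  | _ => simp_all [plift, erase, ErasedPf.rename, upRen_ite]

theorem erase_plift_one (t : Pf) : (t.plift 1 0).erase = t.erase.rename Nat.succ := by
  simp [erase_plift]

/-- The parallel substitution that replaces the variable `k` by `q`. -/
def single (k : ℕ) (q : ErasedPf) (n : ℕ) : ErasedPf :=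
  if n = k then q else if n < k then .var n else .var (n - 1)

theorem up_single (k : ℕ) (q : ErasedPf) :
    ErasedPf.up (single k q) = single (k + 1) (q.rename Nat.succ) := by
  funext n
  cases n with
  | zero => simp [ErasedPf.up, single]
  | succ n =>
    simp only [ErasedPf.up, single, Nat.add_right_cancel_iff, Nat.add_lt_add_iff_right]
    split_ifs
    · rfl
    · rfl
    · simp only [ErasedPf.rename]; congr 1; omega

theorem erase_psubst (t : Pf) (k : ℕ) (q : Pf) :
    (t.psubst k q).erase = t.erase.subst (single k q.erase) := by
  induction t generalizing k q with
  | var n => simp only [psubst]; split_ifs <;> simp_all [erase, ErasedPf.subst, single]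
  | edest => simp_all [psubst, erase, ErasedPf.subst, up_single, erase_plift_one, erase_tlift,
      single]
  | _ => simp_all [psubst, erase, ErasedPf.subst, up_single, erase_plift_one, erase_tlift]

theorem erase_psubst_zero (t q : Pf) : (t.psubst 0 q).erase = t.erase.inst q.erase := by
  rw [erase_psubst]
  congr 1
  funext n
  cases n <;> rfl

end Pf

theorem Step.erase {t t' : Pf} (h : Step t t') : ErasedPf.Red t.erase t'.erase := by
  induction h with
  | beta => rw [Pf.erase_psubst_zero]; exact .beta
  | qbeta => rw [Pf.erase_tsubst]; exact .qbeta
  | @projPair u t b => cases b <;> exact .projPair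
  | @caseInj b u v w => rw [Pf.erase_psubst_zero]; cases b <;> exact .caseInj
  | edestPair => rw [Pf.erase_psubst_zero, Pf.erase_tsubst]; exact .caseInj
  | DinjL => exact .DinjL
  | DinjR => simpa only [Pf.erase, Pf.erase_tsubst] using .DinjR
  | pairL _ ih => exact .pairL ih
  | pairR _ ih => exact .pairR ih
  | projC _ ih => exact .projC ih
  | lamC _ ih => exact .lamC ih
  | appL _ ih => exact .appL ih
  | appR _ ih => exact .appR ih
  | injC _ ih => exact .injC ih
  | caseU _ ih => exact .caseU ih
  | caseL _ ih => exact .caseL ih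
  | caseR _ ih => exact .caseR ih
  | qlamC _ ih => exact .qlamC ih
  | qappC _ ih => exact .qappC ih
  | epairC _ ih => exact .injC ih
  | edestL _ ih => exact .caseU ih
  | edestR _ ih => exact .caseL ih
  | efqC _ ih => exact .efqC ih

namespace ErasedPf

/-- A substitution is reducible for a context. -/
def ReducibleSubst (Γ : List Fml) (σ : ℕ → ErasedPf) : Prop :=
  ∀ n A, Γ[n]? = some A → Reducible A (σ n)

theorem ReducibleSubst.cons {Γ : List Fml} {σ : ℕ → ErasedPf} (h : ReducibleSubst Γ σ)
    {A : Fml} {q : ErasedPf} (hq : Reducible A q) : ReducibleSubst (A :: Γ) (cons q σ) := by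
  intro n B hB
  cases n with
  | zero =>
    cases hB
    exact hq
  | succ n => exact h n B hB

theorem ReducibleSubst.lift {Γ : List Fml} {σ : ℕ → ErasedPf} (h : ReducibleSubst Γ σ) :
    ReducibleSubst (Γ.map (Fml.lift 1 0)) σ := by
  intro n B hB
  rw [List.getElem?_map, Option.map_eq_some_iff] at hB
  obtain ⟨A, hA, rfl⟩ := hB
  rw [reducible_lift]
  exact h n A hA

theorem reducible_of_typed {Γ : List Fml} {t : Pf} {A : Fml} (ht : Typed Γ t A)
    {σ : ℕ → ErasedPf} (hσ : ReducibleSubst Γ σ) : Reducible A (t.erase.subst σ) := by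
  induction ht generalizing σ with
  | var h => exact hσ _ _ h
  | @pair Γ u t A B _ _ ihu iht =>
    have hA := candidate_reducible A
    have hB := candidate_reducible B
    exact ⟨hA.proj_pair hB hA false (fun h _ => h) (ihu hσ) (iht hσ),
      hA.proj_pair hB hB true (fun _ h => h) (ihu hσ) (iht hσ)⟩
  | projL _ ih => exact (ih hσ).1
  | projR _ ih => exact (ih hσ).2
  | @lam Γ u A B _ ih =>
    intro q hq
    refine (candidate_reducible A).app_lam (candidate_reducible B) (fun q hq => ?_) hq
    rw [inst_subst_up]
    exact ih (hσ.cons hq)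
  | app _ _ iht ihu => exact iht hσ _ (ihu hσ)
  | injL _ ih => exact sum_inj_false (candidate_reducible _) (ih hσ)
  | injR _ ih => exact sum_inj_true (candidate_reducible _) (ih hσ)
  | @case Γ u v w A B C _ _ _ ihu ihv ihw =>
    refine (candidate_reducible A).case (candidate_reducible B) (candidate_reducible C)
      (ihu hσ) (fun q hq => ?_) (fun q hq => ?_)
    · rw [inst_subst_up]
      exact ihv (hσ.cons hq)
    · rw [inst_subst_up]
      exact ihw (hσ.cons hq)
  | qlam _ ih => exact (candidate_reducible _).qapp_qlam (ih hσ.lift)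
  | qapp m _ ih =>
    rw [reducible_subst]
    exact ih hσ
  | epair m _ ih =>
    have h := ih hσ
    rw [reducible_subst] at h
    exact sum_inj_false (candidate_reducible _) h
  | @edest Γ u v A C _ _ ihu ihv =>
    have hC := candidate_reducible C
    refine (candidate_reducible A).case candidate_sn hC (ihu hσ) (fun q hq => ?_)
      (fun q hq => ?_)
    · rw [inst_subst_up]
      have h := ihv (hσ.lift.cons hq)
      rwa [reducible_lift] at h
    · change Reducible C (.efq q)
      induction hq with
      | intro q _ ih =>
        refine hC.expand trivial fun s hs => ?_
        cases hs with
        | efqC hr => exact ih _ hr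
  | @efq Γ u P _ hP ih =>
    cases P with
    | atom | bot => exact sn_efq (ih hσ)
    | _ => exact hP.elim
  | @D Γ A B =>
    intro q hq
    change Sum (Reducible A) (Reducible (B.lift 1 0)) (.qapp q) at hq
    rw [reducible_lift] at hq
    exact sum_app_D (candidate_reducible A) (candidate_reducible B) hq

theorem sn_of_typed {Γ : List Fml} {t : Pf} {A : Fml} (ht : Typed Γ t A) : SN t.erase := by
  have hvar : ReducibleSubst Γ var := fun n B _ => (candidate_reducible B).var n
  have h := (candidate_reducible A).sn (reducible_of_typed ht hvar)
  rwa [subst_var] at h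

end ErasedPf

/-- **Strong normalization for CD**: if `t : A` is derivable in CD, then `t`
is strongly normalizable, i.e. there is no infinite reduction sequence
`t ↦ t₁ ↦ t₂ ↦ ⋯` starting from `t`. -/
theorem strong_normalization {Γ : List Fml} {t : Pf} {A : Fml}
    (ht : Typed Γ t A) :
    ¬ ∃ f : ℕ → Pf, f 0 = t ∧ ∀ n, Step (f n) (f (n + 1)) := by
  rintro ⟨f, rfl, hf⟩
  have hacc := ErasedPf.sn_of_typed ht
  clear ht
  generalize hs : (f 0).erase = s at hacc
  induction hacc generalizing f with
  | intro s _ ih =>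
    exact ih _ (hs ▸ (hf 0).erase) (fun n => f (n + 1)) (fun n => hf (n + 1)) rfl
end

section
/- Disjunction property of CD: if the formula A ∨ B is provable in CD (i.e. there is a closed proof term t with CD ⊢ t : A ∨ B), then A is provable in CD or B is provable in CD. -/
namespace Tm

/-- Induction on first-order terms, with the hypothesis available for every argument. -/
theorem arg_induction {P : Tm → Prop} (var : ∀ i, P (.var i)) (const : ∀ k, P (.const k))
    (func : ∀ f ts, (∀ t ∈ ts, P t) → P (.func f ts)) : ∀ t, P t
  | .var i => var i
  | .const k => const k
  | .func f ts => func f ts fun t _ => arg_induction var const func t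

/-- Simultaneous substitution of first-order terms for all variables. -/
def sub (σ : ℕ → Tm) : Tm → Tm
  | var i => σ i
  | const k => const k
  | func f ts => func f (ts.attach.map fun x => sub σ x.1)
termination_by t => sizeOf t
decreasing_by have := List.sizeOf_lt_of_mem x.2; simp; omega

@[simp] theorem sub_var (σ : ℕ → Tm) (i : ℕ) : (var i).sub σ = σ i := by simp [sub]

@[simp] theorem sub_const (σ : ℕ → Tm) (k : ℕ) : (const k).sub σ = const k := by simp [sub]

@[simp] theorem sub_func (σ : ℕ → Tm) (f : ℕ) (ts : List Tm) :
    (func f ts).sub σ = func f (ts.map (sub σ)) := by simp [sub]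

theorem sub_sub (σ τ : ℕ → Tm) (t : Tm) : (t.sub σ).sub τ = t.sub fun i => (σ i).sub τ := by
  induction t using arg_induction with
  | var i => simp
  | const k => simp
  | func f ts ih => simpa using ih

theorem sub_id (t : Tm) : t.sub var = t := by
  induction t using arg_induction with
  | var i => simp
  | const k => simp
  | func f ts ih => simpa using (List.map_congr_left ih).trans (List.map_id' ts)

theorem lift_eq_sub (d c : ℕ) (t : Tm) :
    t.lift d c = t.sub fun i => if i < c then var i else var (i + d) := by
  induction t using arg_induction with
  | var i => simp [lift]
  | const k => simp [lift]
  | func f ts ih => simpa [lift] using ih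

theorem subst_eq_sub (k : ℕ) (m t : Tm) :
    subst k m t = t.sub fun i => if i = k then m else if i < k then var i else var (i - 1) := by
  induction t using arg_induction with
  | var i => simp [subst]
  | const k => simp [subst]
  | func f ts ih => simpa [subst] using ih

theorem exists_bound_list (ts : List Tm)
    (h : ∀ t ∈ ts, ∃ N, ∀ σ τ : ℕ → Tm, (∀ i < N, σ i = τ i) → t.sub σ = t.sub τ) :
    ∃ N, ∀ σ τ : ℕ → Tm, (∀ i < N, σ i = τ i) → ts.map (sub σ) = ts.map (sub τ) := by
  induction ts with
  | nil => exact ⟨0, by simp⟩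
  | cons t ts ih =>
    obtain ⟨N, hN⟩ := h t (by simp)
    obtain ⟨M, hM⟩ := ih fun s hs => h s (by simp [hs])
    refine ⟨N + M, fun σ τ e => ?_⟩
    rw [List.map_cons, List.map_cons, hN σ τ fun i hi => e i (by omega),
      hM σ τ fun i hi => e i (by omega)]

/-- A term has finitely many variables. -/
theorem exists_bound (t : Tm) :
    ∃ N, ∀ σ τ : ℕ → Tm, (∀ i < N, σ i = τ i) → t.sub σ = t.sub τ := by
  induction t using arg_induction with
  | var i => exact ⟨i + 1, fun σ τ e => by simpa using e i (by omega)⟩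
  | const k => exact ⟨0, by simp⟩
  | func f ts ih => simpa using exists_bound_list ts ih

/-- The substitution sending variable `0` to `m` and variable `i + 1` to `σ i`. -/
def scons (m : Tm) (σ : ℕ → Tm) : ℕ → Tm
  | 0 => m
  | i + 1 => σ i

/-- The substitution `σ` transported under a first-order binder. -/
def up (σ : ℕ → Tm) : ℕ → Tm :=
  scons (var 0) fun i => (σ i).sub fun j => var (j + 1)

theorem scons_sub (m : Tm) (σ τ : ℕ → Tm) :
    (fun i => (scons m σ i).sub τ) = scons (m.sub τ) fun i => (σ i).sub τ := by
  funext i; cases i <;> rfl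

theorem up_sub_scons (m : Tm) (σ τ : ℕ → Tm) :
    (fun i => (up σ i).sub (scons m τ)) = scons m fun i => (σ i).sub τ := by
  rw [up, scons_sub]
  simp [sub_sub, scons]

theorem up_sub_up (σ τ : ℕ → Tm) :
    (fun i => (up σ i).sub (up τ)) = up fun i => (σ i).sub τ := by
  conv_lhs => rw [up.eq_def τ]
  rw [up_sub_scons]
  simp [up, sub_sub]

end Tm

namespace Fml

open Tm

/-- Simultaneous substitution of first-order terms for all free variables. -/
def sub : (ℕ → Tm) → Fml → Fml
  | σ, atom P ts => atom P (ts.map (Tm.sub σ))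
  | _, bot => bot
  | σ, conj A B => conj (sub σ A) (sub σ B)
  | σ, disj A B => disj (sub σ A) (sub σ B)
  | σ, impl A B => impl (sub σ A) (sub σ B)
  | σ, all A => all (sub (up σ) A)
  | σ, ex A => ex (sub (up σ) A)

theorem sub_sub (σ τ : ℕ → Tm) (A : Fml) :
    (A.sub σ).sub τ = A.sub fun i => (σ i).sub τ := by
  induction A generalizing σ τ <;> simp_all [sub, up_sub_up, Tm.sub_sub]

theorem sub_id (A : Fml) : A.sub Tm.var = A := by
  have hup : up Tm.var = Tm.var := by funext i; cases i <;> simp [up, scons]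
  induction A <;> simp_all [sub]
  exact List.map_id'' Tm.sub_id _

theorem lift_eq_sub (d c : ℕ) (A : Fml) :
    A.lift d c = A.sub fun i => if i < c then Tm.var i else Tm.var (i + d) := by
  have hup (c : ℕ) : up (fun i => if i < c then Tm.var i else Tm.var (i + d)) =
      fun i => if i < c + 1 then Tm.var i else Tm.var (i + d) := by
    funext i
    cases i with
    | zero => simp [up, scons]
    | succ i =>
      by_cases h : i < c
      · simp [up, scons, h]
      · simp [up, scons, h]; omega
  induction A generalizing c <;> simp_all [sub, lift, Tm.lift_eq_sub]

theorem subst_eq_sub (k : ℕ) (m : Tm) (A : Fml) : A.subst k m =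
    A.sub fun i => if i = k then m else if i < k then Tm.var i else Tm.var (i - 1) := by
  have hup (k : ℕ) (m : Tm) :
      up (fun i => if i = k then m else if i < k then Tm.var i else Tm.var (i - 1)) =
      fun i => if i = k + 1 then m.lift 1 0 else if i < k + 1 then Tm.var i
        else Tm.var (i - 1) := by
    funext i
    cases i with
    | zero => simp [up, scons]
    | succ i =>
      rcases lt_trichotomy i k with h | h | h
      · simp [up, scons, h, h.ne]
      · simp [up, scons, h, Tm.lift_eq_sub]
      · simp [up, scons, h.ne', h.not_gt]; omega
  induction A generalizing k m <;> simp_all [sub, subst, Tm.subst_eq_sub]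

theorem lift_one_eq_sub (A : Fml) : A.lift 1 0 = A.sub fun i => Tm.var (i + 1) := by
  simp [lift_eq_sub]

theorem subst_zero_eq_sub (m : Tm) (A : Fml) : A.subst 0 m = A.sub (scons m Tm.var) := by
  rw [subst_eq_sub]
  congr 1
  funext i
  cases i <;> simp [scons]

theorem sub_lift (σ : ℕ → Tm) (A : Fml) : (A.lift 1 0).sub (up σ) = (A.sub σ).lift 1 0 := by
  simp [lift_one_eq_sub, sub_sub, up, scons]

theorem sub_subst (σ : ℕ → Tm) (m : Tm) (A : Fml) :
    (A.subst 0 m).sub σ = (A.sub (up σ)).subst 0 (m.sub σ) := by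
  simp [subst_zero_eq_sub, sub_sub, up_sub_scons, scons_sub, Tm.sub_id]

theorem sub_up_subst (σ : ℕ → Tm) (m : Tm) (A : Fml) :
    (A.sub (up σ)).subst 0 m = A.sub (scons m σ) := by
  simp [subst_zero_eq_sub, sub_sub, up_sub_scons, Tm.sub_id]

theorem map_lift_map_sub (σ : ℕ → Tm) (Γ : List Fml) :
    (Γ.map (lift 1 0)).map (sub (up σ)) = (Γ.map (sub σ)).map (lift 1 0) := by
  simp [sub_lift]

theorem Atomic.sub {A : Fml} (h : A.Atomic) (σ : ℕ → Tm) : (A.sub σ).Atomic := by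
  cases A <;> simp_all [Atomic, Fml.sub]

/-- A formula has finitely many free variables. -/
theorem exists_bound (A : Fml) :
    ∃ N, ∀ σ τ : ℕ → Tm, (∀ i < N, σ i = τ i) → A.sub σ = A.sub τ := by
  have hup {N : ℕ} {σ τ : ℕ → Tm} (e : ∀ i < N, σ i = τ i) : ∀ i < N, up σ i = up τ i := by
    rintro (_ | i) hi
    · rfl
    · simp [up, scons, e i (by omega)]
  induction A with
  | atom P ts => simpa [sub] using exists_bound_list ts fun t _ => t.exists_bound
  | bot => exact ⟨0, by simp [sub]⟩
  | conj A B ihA ihB | disj A B ihA ihB | impl A B ihA ihB =>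
    obtain ⟨N, hN⟩ := ihA
    obtain ⟨M, hM⟩ := ihB
    refine ⟨N + M, fun σ τ e => ?_⟩
    simp only [sub]
    rw [hN σ τ fun i hi => e i (by omega), hM σ τ fun i hi => e i (by omega)]
  | all A ih | ex A ih =>
    obtain ⟨N, hN⟩ := ih
    exact ⟨N, fun σ τ e => by simp only [sub]; rw [hN _ _ (hup e)]⟩

end Fml

open Tm (scons up)

/-- `A` is derivable from the context `Γ`. -/
def Derivable (Γ : List Fml) (A : Fml) : Prop := ∃ t, Typed Γ t A

namespace Derivable

theorem of_mem {Γ : List Fml} {A : Fml} (h : A ∈ Γ) : Derivable Γ A := by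
  obtain ⟨n, hn⟩ := List.mem_iff_getElem?.1 h
  exact ⟨_, .var hn⟩

theorem impl_intro {Γ : List Fml} {A B : Fml} : Derivable (A :: Γ) B → Derivable Γ (.impl A B)
  | ⟨_, h⟩ => ⟨_, h.lam⟩

theorem impl_elim {Γ : List Fml} {A B : Fml} :
    Derivable Γ (.impl A B) → Derivable Γ A → Derivable Γ B
  | ⟨_, h⟩, ⟨_, h'⟩ => ⟨_, h.app h'⟩

end Derivable

namespace Typed

theorem weaken {Γ Δ : List Fml} {t : Pf} {A : Fml} (h : Typed Γ t A) (hs : Γ ⊆ Δ) :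
    Derivable Δ A := by
  induction h generalizing Δ with
  | var h => exact .of_mem (hs (List.mem_of_getElem? h))
  | pair _ _ ih₁ ih₂ =>
    obtain ⟨_, h₁⟩ := ih₁ hs
    obtain ⟨_, h₂⟩ := ih₂ hs
    exact ⟨_, h₁.pair h₂⟩
  | projL _ ih => obtain ⟨_, h⟩ := ih hs; exact ⟨_, h.projL⟩
  | projR _ ih => obtain ⟨_, h⟩ := ih hs; exact ⟨_, h.projR⟩
  | lam _ ih => exact (ih (List.cons_subset_cons _ hs)).impl_intro
  | app _ _ ih₁ ih₂ => exact (ih₁ hs).impl_elim (ih₂ hs)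
  | injL _ ih => obtain ⟨_, h⟩ := ih hs; exact ⟨_, h.injL⟩
  | injR _ ih => obtain ⟨_, h⟩ := ih hs; exact ⟨_, h.injR⟩
  | case _ _ _ ih ih₁ ih₂ =>
    obtain ⟨_, h⟩ := ih hs
    obtain ⟨_, h₁⟩ := ih₁ (List.cons_subset_cons _ hs)
    obtain ⟨_, h₂⟩ := ih₂ (List.cons_subset_cons _ hs)
    exact ⟨_, h.case h₁ h₂⟩
  | qlam _ ih => obtain ⟨_, h⟩ := ih (List.map_subset _ hs); exact ⟨_, h.qlam⟩
  | qapp m _ ih => obtain ⟨_, h⟩ := ih hs; exact ⟨_, h.qapp m⟩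
  | epair m _ ih => obtain ⟨_, h⟩ := ih hs; exact ⟨_, h.epair m⟩
  | edest _ _ ih₁ ih₂ =>
    obtain ⟨_, h₁⟩ := ih₁ hs
    obtain ⟨_, h₂⟩ := ih₂ (List.cons_subset_cons _ (List.map_subset _ hs))
    exact ⟨_, h₁.edest h₂⟩
  | efq _ ha ih => obtain ⟨_, h⟩ := ih hs; exact ⟨_, h.efq ha⟩
  | D => exact ⟨_, .D⟩

/-- Derivability is closed under simultaneous substitution of first-order terms. -/
theorem sub {Γ : List Fml} {t : Pf} {A : Fml} (h : Typed Γ t A) (σ : ℕ → Tm) :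
    Derivable (Γ.map (Fml.sub σ)) (A.sub σ) := by
  induction h generalizing σ with
  | var h => exact .of_mem (List.mem_map_of_mem (List.mem_of_getElem? h))
  | pair _ _ ih₁ ih₂ =>
    obtain ⟨_, h₁⟩ := ih₁ σ
    obtain ⟨_, h₂⟩ := ih₂ σ
    exact ⟨_, h₁.pair h₂⟩
  | projL _ ih => obtain ⟨_, h⟩ := ih σ; exact ⟨_, h.projL⟩
  | projR _ ih => obtain ⟨_, h⟩ := ih σ; exact ⟨_, h.projR⟩
  | lam _ ih => exact (ih σ).impl_intro
  | app _ _ ih₁ ih₂ => exact (ih₁ σ).impl_elim (ih₂ σ)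
  | injL _ ih => obtain ⟨_, h⟩ := ih σ; exact ⟨_, h.injL⟩
  | injR _ ih => obtain ⟨_, h⟩ := ih σ; exact ⟨_, h.injR⟩
  | case _ _ _ ih ih₁ ih₂ =>
    obtain ⟨_, h⟩ := ih σ
    obtain ⟨_, h₁⟩ := ih₁ σ
    obtain ⟨_, h₂⟩ := ih₂ σ
    exact ⟨_, h.case h₁ h₂⟩
  | qlam _ ih =>
    obtain ⟨_, h⟩ := ih (up σ)
    rw [Fml.map_lift_map_sub] at h
    exact ⟨_, h.qlam⟩
  | qapp m _ ih =>
    obtain ⟨_, h⟩ := ih σ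
    rw [Fml.sub_subst]
    exact ⟨_, h.qapp _⟩
  | epair m _ ih =>
    obtain ⟨_, h⟩ := ih σ
    rw [Fml.sub_subst] at h
    exact ⟨_, h.epair _⟩
  | edest _ _ ih₁ ih₂ =>
    obtain ⟨_, h₁⟩ := ih₁ σ
    obtain ⟨_, h₂⟩ := ih₂ (up σ)
    rw [List.map_cons, Fml.map_lift_map_sub, Fml.sub_lift] at h₂
    exact ⟨_, h₁.edest h₂⟩
  | efq _ ha ih => obtain ⟨_, h⟩ := ih σ; exact ⟨_, h.efq (ha.sub σ)⟩
  | D => simp only [Fml.sub, Fml.sub_lift]; exact ⟨_, .D⟩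

end Typed

namespace Derivable

/-- Derivable hypotheses can be discharged. -/
theorem discharge {Γ : List Fml} {A : Fml} (h : Derivable Γ A)
    (hΓ : ∀ B ∈ Γ, Derivable [] B) : Derivable [] A := by
  induction Γ generalizing A with
  | nil => exact h
  | cons B Γ ih =>
    exact (ih h.impl_intro fun C hC => hΓ C (by simp [hC])).impl_elim (hΓ B (by simp))

/-- A formula derivable at every variable is derivable universally quantified. -/
theorem all_of_forall_var {A : Fml} (h : ∀ n, Derivable [] (A.subst 0 (.var n))) :
    Derivable [] (.all A) := by
  obtain ⟨N, hN⟩ := A.exists_bound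
  obtain ⟨t, ht⟩ := h N
  have h' := ht.sub fun i => if i = N then Tm.var 0 else Tm.var (i + 1)
  rw [Fml.subst_zero_eq_sub, Fml.sub_sub, Tm.scons_sub, hN _ Tm.var, Fml.sub_id] at h'
  · obtain ⟨u, hu⟩ := h'
    exact ⟨_, .qlam hu⟩
  · rintro (_ | i) hi
    · simp [scons]
    · simp [scons, show i ≠ N by omega]

end Derivable

/-- The Kleene slash for CD, relative to an assignment of terms to the free variables. -/
def Slash : Fml → (ℕ → Tm) → Prop
  | .atom P ts, σ => Derivable [] ((Fml.atom P ts).sub σ)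
  | .bot, _ => Derivable [] .bot
  | .conj A B, σ => Slash A σ ∧ Slash B σ
  | .disj A B, σ => Slash A σ ∨ Slash B σ
  | .impl A B, σ => Derivable [] ((Fml.impl A B).sub σ) ∧ (Slash A σ → Slash B σ)
  | .all A, σ => Derivable [] ((Fml.all A).sub σ) ∧ ∀ m, Slash A (scons m σ)
  | .ex A, σ => ∃ m, Slash A (scons m σ)

namespace Slash

theorem derivable {A : Fml} {σ : ℕ → Tm} (h : Slash A σ) : Derivable [] (A.sub σ) := by
  induction A generalizing σ with
  | atom | bot => exact h
  | conj A B ihA ihB =>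
    obtain ⟨_, h₁⟩ := ihA h.1
    obtain ⟨_, h₂⟩ := ihB h.2
    exact ⟨_, h₁.pair h₂⟩
  | disj A B ihA ihB =>
    rcases h with h | h
    · obtain ⟨_, h⟩ := ihA h
      exact ⟨_, h.injL⟩
    · obtain ⟨_, h⟩ := ihB h
      exact ⟨_, h.injR⟩
  | impl | all => exact h.1
  | ex A ih =>
    obtain ⟨m, h⟩ := h
    obtain ⟨_, h⟩ := ih h
    rw [← Fml.sub_up_subst] at h
    exact ⟨_, h.epair m⟩

theorem sub_iff (A : Fml) (τ σ : ℕ → Tm) :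
    Slash (A.sub τ) σ ↔ Slash A fun i => (τ i).sub σ := by
  induction A generalizing τ σ with
  | atom P ts => rw [Fml.sub, Slash, Slash, ← Fml.sub, Fml.sub_sub]
  | bot => rfl
  | conj A B ihA ihB | disj A B ihA ihB => simp only [Fml.sub, Slash, ihA, ihB]
  | impl A B ihA ihB => simp only [Fml.sub, Slash, ihA, ihB, Fml.sub_sub]
  | all A ih => simp only [Fml.sub, Slash, ih, Fml.sub_sub, Tm.up_sub_up, Tm.up_sub_scons]
  | ex A ih => simp only [Fml.sub, Slash, ih, Tm.up_sub_scons]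

theorem lift_iff (A : Fml) (m : Tm) (σ : ℕ → Tm) :
    Slash (A.lift 1 0) (scons m σ) ↔ Slash A σ := by
  simp [Fml.lift_one_eq_sub, sub_iff, scons]

theorem subst_iff (A : Fml) (m : Tm) (σ : ℕ → Tm) :
    Slash (A.subst 0 m) σ ↔ Slash A (scons (m.sub σ) σ) := by
  simp [Fml.subst_zero_eq_sub, sub_iff, Tm.scons_sub]

end Slash

theorem Typed.slash {Γ : List Fml} {t : Pf} {A : Fml} (h : Typed Γ t A) (σ : ℕ → Tm)
    (hΓ : ∀ B ∈ Γ, Slash B σ) : Slash A σ := by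
  have closed {Γ : List Fml} {t : Pf} {A : Fml} (h : Typed Γ t A) {σ : ℕ → Tm}
      (hΓ : ∀ B ∈ Γ, Slash B σ) : Derivable [] (A.sub σ) :=
    (h.sub σ).discharge (by simpa using fun B hB => (hΓ B hB).derivable)
  induction h generalizing σ with
  | var h => exact hΓ _ (List.mem_of_getElem? h)
  | pair _ _ ih₁ ih₂ => exact ⟨ih₁ σ hΓ, ih₂ σ hΓ⟩
  | projL _ ih => exact (ih σ hΓ).1
  | projR _ ih => exact (ih σ hΓ).2
  | lam h ih => exact ⟨closed h.lam hΓ, fun hA => ih σ (by simpa using ⟨hA, hΓ⟩)⟩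
  | app _ _ ih₁ ih₂ => exact (ih₁ σ hΓ).2 (ih₂ σ hΓ)
  | injL _ ih => exact .inl (ih σ hΓ)
  | injR _ ih => exact .inr (ih σ hΓ)
  | case _ _ _ ih ih₁ ih₂ =>
    rcases ih σ hΓ with h | h
    · exact ih₁ σ (by simpa using ⟨h, hΓ⟩)
    · exact ih₂ σ (by simpa using ⟨h, hΓ⟩)
  | qlam h ih =>
    exact ⟨closed h.qlam hΓ, fun m => ih _ (by simpa [Slash.lift_iff] using hΓ)⟩
  | qapp m _ ih => exact (Slash.subst_iff ..).2 ((ih σ hΓ).2 _)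
  | epair m _ ih => exact ⟨_, (Slash.subst_iff ..).1 (ih σ hΓ)⟩
  | edest _ _ ih₁ ih₂ =>
    obtain ⟨m, h⟩ := ih₁ σ hΓ
    exact (Slash.lift_iff _ m σ).1 (ih₂ _ (by simpa [Slash.lift_iff] using ⟨h, hΓ⟩))
  | @efq _ _ P _ ha ih =>
    obtain ⟨_, h⟩ : Derivable [] .bot := ih σ hΓ
    cases P with
    | atom | bot => exact ⟨_, h.efq trivial⟩
    | _ => exact ha.elim
  | @D _ A B =>
    refine ⟨closed (Γ := []) .D (by simp), fun h => ?_⟩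
    by_cases hB : Slash B σ
    · exact .inr hB
    · have hA (m : Tm) : Slash A (scons m σ) :=
        (h.2 m).resolve_right fun h' => hB ((Slash.lift_iff ..).1 h')
      refine .inl ⟨.all_of_forall_var fun n => ?_, hA⟩
      rw [Fml.sub_up_subst]
      exact (hA _).derivable

/-- **Disjunction property of CD**: if `A ∨ B` is provable in CD (there is a
closed proof term `t` with `CD ⊢ t : A ∨ B`), then `A` is provable in CD or
`B` is provable in CD. -/
theorem disjunction_property {A B : Fml}
    (h : ∃ t : Pf, Typed [] t (.disj A B)) :
    (∃ u : Pf, Typed [] u A) ∨ (∃ u : Pf, Typed [] u B) := by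
  obtain ⟨t, ht⟩ := h
  have closed {C : Fml} (hC : Slash C Tm.var) : Derivable [] C := C.sub_id ▸ hC.derivable
  exact (ht.slash Tm.var (by simp)).imp closed closed
end

section
/- CD proves the excluded middle over decidable formulas: for every formula A(α), the formula ∀α(A(α) ∨ ¬A(α)) → (∀α A(α) ∨ ∃α ¬A(α)) is provable in CD. -/
/-- Lifting past variable `k` and then renaming variable `k` to itself is the identity. -/
theorem Tm.subst_var_lift_succ (k : ℕ) (t : Tm) :
    Tm.subst k (.var k) (t.lift 1 (k + 1)) = t := by
  match t with
  | .var i =>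
    simp only [Tm.lift]
    split_ifs with h
    · simp only [Tm.subst]
      split_ifs <;> grind
    · simp only [Tm.subst]
      split_ifs <;> grind
  | .const c => simp only [Tm.lift, Tm.subst]
  | .func f ts =>
    have ih : ∀ x ∈ ts, Tm.subst k (.var k) (x.lift 1 (k + 1)) = x := fun x _ =>
      Tm.subst_var_lift_succ k x
    simp only [Tm.lift, Tm.subst, List.map_attach_eq_pmap, List.pmap_eq_map, List.map_map]
    congr 1
    exact (List.map_congr_left ih).trans (List.map_id _)
termination_by sizeOf t
decreasing_by
  have := List.sizeOf_lt_of_mem ‹_ ∈ ts›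
  simp
  omega

theorem Fml.subst_var_lift_succ (k : ℕ) (A : Fml) :
    Fml.subst k (.var k) (A.lift 1 (k + 1)) = A := by
  induction A generalizing k with
  | atom P ts =>
    simp only [Fml.lift, Fml.subst, List.map_map]
    congr 1
    exact (List.map_congr_left fun x _ => Tm.subst_var_lift_succ k x).trans (List.map_id _)
  | bot => rfl
  | _ => simp_all [Fml.lift, Fml.subst, Tm.lift]

/-- **CD proves the excluded middle over decidable formulas**: for every
formula `A(α)` (de Bruijn: `A` with free variable `0` bound by the displayed
quantifiers), the formula `∀α(A(α) ∨ ¬A(α)) → ∀α A(α) ∨ ∃α ¬A(α)` is provable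
in CD, where `¬A` abbreviates `A → ⊥`. -/
theorem em_over_decidable (A : Fml) :
    ∃ t : Pf, Typed [] t
      (.impl (.all (.disj A (.impl A .bot)))
             (.disj (.all A) (.ex (.impl A .bot)))) := by
  have hA := A.subst_var_lift_succ 0
  refine ⟨.lam _ (.app (.D A (.ex (.impl A .bot))) (.qlam (.case (.qapp (.var 0) (.var 0))
    (.inj false (.var 0)) (.inj true (.epair (.var 0) (.var 0)))))),
    .lam (.app .D (.qlam (.case (A := A) (B := .impl A .bot) ?_ (.injL (.var rfl))
      (.injR (.epair _ (.var ?_))))))⟩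
  · have h := Typed.qapp (Γ := [.all (.disj (A.lift 1 1) (.impl (A.lift 1 1) .bot))])
      (.var 0) (.var (n := 0) rfl)
    simpa [Fml.subst, Fml.lift, hA] using h
  · simp [Fml.subst, Fml.lift, hA]
end
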